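/- For every p ≥ 2, Singular(p,2) = Singular(2,2); in particular the union Singular(∞,2) = ⋃_{p ≥ 2} Singular(p,2) equals Singular(2,2). -/

import Mathlib

open Matrix

/-- The eigenvalues of a Hermitian matrix, listed in decreasing order. -/
noncomputable def eigsDesc {n : ℕ} {A : Matrix (Fin n) (Fin n) ℂ} (hA : A.IsHermitian) :
    Fin n → ℝ :=
  fun i => hA.eigenvalues (Tuple.sort hA.eigenvalues i.rev)

/-- The singular values of a complex `p × q` matrix, listed in decreasing order:
the square roots of the eigenvalues of the Hermitian matrix `Aᴴ * A`. -/
noncomputable def singularValues {p q : ℕ} (A : Matrix (Fin p) (Fin q) ℂ) : Fin q → ℝ :=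
  fun i => Real.sqrt (eigsDesc (Matrix.isHermitian_conjTranspose_mul_self A) i)

/-- `sval A k` is the `k`-th singular value `τ_k(A)` of `A`, with 1-based indexing
(junk value `0` out of range). -/
noncomputable def sval {p q : ℕ} (A : Matrix (Fin p) (Fin q) ℂ) (k : ℕ) : ℝ :=
  if h : k - 1 < q then singularValues A ⟨k - 1, h⟩ else 0

/-- `SingularCone p q` is the set of triples `(τ(A), τ(B), τ(C))` of singular value vectors
of complex `p × q` matrices `A`, `B`, `C` with `A + B + C = 0`. -/
def SingularCone (p q : ℕ) : Set ((Fin q → ℝ) × (Fin q → ℝ) × (Fin q → ℝ)) :=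
  {t | ∃ A B C : Matrix (Fin p) (Fin q) ℂ, A + B + C = 0 ∧
      singularValues A = t.1 ∧ singularValues B = t.2.1 ∧ singularValues C = t.2.2}

/-- The prescribed Frobenius norm and modulus of the determinant characterise the singular values
`s.1 ≥ s.2 ≥ 0` of a `2 × 2` matrix. -/
def HasSingularPair (M : Matrix (Fin 2) (Fin 2) ℂ) (s : ℝ × ℝ) : Prop :=
  ‖M 0 0‖ ^ 2 + ‖M 0 1‖ ^ 2 + ‖M 1 0‖ ^ 2 + ‖M 1 1‖ ^ 2 = s.1 ^ 2 + s.2 ^ 2 ∧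
    ‖M.det‖ = s.1 * s.2

/-- The pairs `a`, `b`, `c` are singular values of `2 × 2` matrices with sum zero. -/
def Realizable (a b c : ℝ × ℝ) : Prop :=
  ∃ A B C : Matrix (Fin 2) (Fin 2) ℂ, A + B + C = 0 ∧
    HasSingularPair A a ∧ HasSingularPair B b ∧ HasSingularPair C c

lemma Realizable.swap {a b c : ℝ × ℝ} (h : Realizable a b c) : Realizable b a c := by
  obtain ⟨A, B, C, h, hA, hB, hC⟩ := h
  exact ⟨B, A, C, by rw [add_comm B A, h], hB, hA, hC⟩

lemma Realizable.rotate {a b c : ℝ × ℝ} (h : Realizable a b c) : Realizable b c a := by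
  obtain ⟨A, B, C, h, hA, hB, hC⟩ := h
  exact ⟨B, C, A, by rw [← h]; abel, hB, hC, hA⟩

/-- The three numbers satisfy the triangle inequalities. -/
def IsTriangle (x y z : ℝ) : Prop := x ≤ y + z ∧ y ≤ x + z ∧ z ≤ x + y

lemma IsTriangle.exists_complex {x y z : ℝ} (h : IsTriangle x y z) :
    ∃ u v w : ℂ, u + v + w = 0 ∧ ‖u‖ = x ∧ ‖v‖ = y ∧ ‖w‖ = z := by
  obtain ⟨h₁, h₂, h₃⟩ := h
  have hx : 0 ≤ x := by linarith
  have hy : 0 ≤ y := by linarith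
  have hz : 0 ≤ z := by linarith
  rcases hx.eq_or_lt with rfl | hx'
  · have : y = z := by linarith
    subst this
    exact ⟨0, y, -y, by simp, by simp, by simp [abs_of_nonneg hy], by simp [abs_of_nonneg hy]⟩
  set p : ℝ := (x ^ 2 + y ^ 2 - z ^ 2) / (2 * x) with hp
  have hpx : 2 * x * p = x ^ 2 + y ^ 2 - z ^ 2 := by rw [hp]; field_simp
  have hpy : p ^ 2 ≤ y ^ 2 := by
    apply sq_le_sq' <;> nlinarith
  have hq := Real.sq_sqrt (sub_nonneg.2 hpy)
  set q : ℝ := √(y ^ 2 - p ^ 2)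
  refine ⟨-x, ⟨p, q⟩, ⟨x - p, -q⟩, ?_, by simp [abs_of_nonneg hx], ?_, ?_⟩
  · apply Complex.ext <;> simp
  · rw [← sq_eq_sq₀ (norm_nonneg _) hy, Complex.sq_norm, Complex.normSq_mk]
    linarith
  · rw [← sq_eq_sq₀ (norm_nonneg _) hz, Complex.sq_norm, Complex.normSq_mk]
    nlinarith

lemma hasSingularPair_diag {u v : ℂ} {s : ℝ × ℝ}
    (h : ‖u‖ = s.1 ∧ ‖v‖ = s.2 ∨ ‖u‖ = s.2 ∧ ‖v‖ = s.1) :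
    HasSingularPair !![u, 0; 0, v] s := by
  rcases h with ⟨h, h'⟩ | ⟨h, h'⟩ <;>
    simp [HasSingularPair, Matrix.det_fin_two, h, h', add_comm, mul_comm]

lemma realizable_of_isTriangle {a b c : ℝ × ℝ} (h₁ : IsTriangle a.1 b.1 c.1)
    (h₂ : IsTriangle a.2 b.2 c.2) : Realizable a b c := by
  obtain ⟨u, v, w, h, hu, hv, hw⟩ := h₁.exists_complex
  obtain ⟨u', v', w', h', hu', hv', hw'⟩ := h₂.exists_complex
  refine ⟨!![u, 0; 0, u'], !![v, 0; 0, v'], !![w, 0; 0, w'], ?_,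
    hasSingularPair_diag (.inl ⟨hu, hu'⟩), hasSingularPair_diag (.inl ⟨hv, hv'⟩),
    hasSingularPair_diag (.inl ⟨hw, hw'⟩)⟩
  ext i j
  fin_cases i <;> fin_cases j <;> simp [h, h']

lemma realizable_of_isTriangle_swap {a b c : ℝ × ℝ} (h₁ : IsTriangle a.1 b.1 c.2)
    (h₂ : IsTriangle a.2 b.2 c.1) : Realizable a b c := by
  obtain ⟨u, v, w, h, hu, hv, hw⟩ := h₁.exists_complex
  obtain ⟨u', v', w', h', hu', hv', hw'⟩ := h₂.exists_complex
  refine ⟨!![u, 0; 0, u'], !![v, 0; 0, v'], !![w, 0; 0, w'], ?_,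
    hasSingularPair_diag (.inl ⟨hu, hu'⟩), hasSingularPair_diag (.inl ⟨hv, hv'⟩),
    hasSingularPair_diag (.inr ⟨hw, hw'⟩)⟩
  ext i j
  fin_cases i <;> fin_cases j <;> simp [h, h']

/-- The real `2 × 2` matrix with conformal part `z` and anticonformal part `w`. -/
def conformalMatrix (z w : ℂ) : Matrix (Fin 2) (Fin 2) ℂ :=
  !![((z.re + w.re : ℝ) : ℂ), ((w.im - z.im : ℝ) : ℂ);
     ((z.im + w.im : ℝ) : ℂ), ((z.re - w.re : ℝ) : ℂ)]

lemma hasSingularPair_conformalMatrix {z w : ℂ} {s : ℝ × ℝ} (hs : 0 ≤ s.1 * s.2)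
    (h : ‖z‖ = (s.1 + s.2) / 2 ∧ ‖w‖ = (s.1 - s.2) / 2 ∨
      ‖z‖ = (s.1 - s.2) / 2 ∧ ‖w‖ = (s.1 + s.2) / 2) :
    HasSingularPair (conformalMatrix z w) s := by
  have key : ‖z‖ ^ 2 + ‖w‖ ^ 2 = (s.1 ^ 2 + s.2 ^ 2) / 2 ∧
      |‖z‖ ^ 2 - ‖w‖ ^ 2| = s.1 * s.2 := by
    rcases h with ⟨h, h'⟩ | ⟨h, h'⟩ <;> rw [h, h'] <;> refine ⟨by ring, ?_⟩
    · rw [← abs_of_nonneg hs]; congr 1; ring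
    · rw [← abs_of_nonneg hs, ← abs_neg]; congr 1; ring
  rw [Complex.sq_norm, Complex.sq_norm, Complex.normSq_apply, Complex.normSq_apply] at key
  constructor
  · simp only [conformalMatrix, Matrix.of_apply, Matrix.cons_val', Matrix.cons_val_zero,
      Matrix.cons_val_one, Matrix.cons_val_fin_one, Complex.norm_real, Real.norm_eq_abs, sq_abs]
    linarith [key.1]
  · rw [← key.2, ← Real.norm_eq_abs, ← Complex.norm_real, conformalMatrix, Matrix.det_fin_two_of]
    congr 1
    push_cast
    ring

lemma conformalMatrix_add_eq_zero {u v w u' v' w' : ℂ} (h : u + v + w = 0)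
    (h' : u' + v' + w' = 0) :
    conformalMatrix u u' + conformalMatrix v v' + conformalMatrix w w' = 0 := by
  have e₁ := congr_arg Complex.re h
  have e₂ := congr_arg Complex.im h
  have e₃ := congr_arg Complex.re h'
  have e₄ := congr_arg Complex.im h'
  simp only [Complex.add_re, Complex.add_im, Complex.zero_re, Complex.zero_im] at e₁ e₂ e₃ e₄
  ext i j
  fin_cases i <;> fin_cases j <;> simp only [conformalMatrix] <;> simp <;> norm_cast <;> linarith

lemma IsTriangle.half {x y z : ℝ} (h : IsTriangle x y z) :
    IsTriangle (x / 2) (y / 2) (z / 2) := by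
  obtain ⟨h₁, h₂, h₃⟩ := h
  refine ⟨?_, ?_, ?_⟩ <;> linarith

/-- A pair listing two nonnegative numbers in decreasing order. -/
def IsSortedPair (s : ℝ × ℝ) : Prop := 0 ≤ s.2 ∧ s.2 ≤ s.1

lemma IsSortedPair.mul_nonneg {s : ℝ × ℝ} (h : IsSortedPair s) : 0 ≤ s.1 * s.2 :=
  _root_.mul_nonneg (h.1.trans h.2) h.1

lemma realizable_of_isTriangle_add_sub {a b c : ℝ × ℝ}
    (ha : IsSortedPair a) (hb : IsSortedPair b) (hc : IsSortedPair c)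
    (h₁ : IsTriangle (a.1 + a.2) (b.1 + b.2) (c.1 + c.2))
    (h₂ : IsTriangle (a.1 - a.2) (b.1 - b.2) (c.1 - c.2)) : Realizable a b c := by
  obtain ⟨u, v, w, h, hu, hv, hw⟩ := h₁.half.exists_complex
  obtain ⟨u', v', w', h', hu', hv', hw'⟩ := h₂.half.exists_complex
  exact ⟨_, _, _, conformalMatrix_add_eq_zero h h',
    hasSingularPair_conformalMatrix ha.mul_nonneg (.inl ⟨hu, hu'⟩),
    hasSingularPair_conformalMatrix hb.mul_nonneg (.inl ⟨hv, hv'⟩),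
    hasSingularPair_conformalMatrix hc.mul_nonneg (.inl ⟨hw, hw'⟩)⟩

lemma realizable_of_isTriangle_add_sub_swap {a b c : ℝ × ℝ}
    (ha : IsSortedPair a) (hb : IsSortedPair b) (hc : IsSortedPair c)
    (h₁ : IsTriangle (a.1 + a.2) (b.1 + b.2) (c.1 - c.2))
    (h₂ : IsTriangle (a.1 - a.2) (b.1 - b.2) (c.1 + c.2)) : Realizable a b c := by
  obtain ⟨u, v, w, h, hu, hv, hw⟩ := h₁.half.exists_complex
  obtain ⟨u', v', w', h', hu', hv', hw'⟩ := h₂.half.exists_complex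
  exact ⟨_, _, _, conformalMatrix_add_eq_zero h h',
    hasSingularPair_conformalMatrix ha.mul_nonneg (.inl ⟨hu, hu'⟩),
    hasSingularPair_conformalMatrix hb.mul_nonneg (.inl ⟨hv, hv'⟩),
    hasSingularPair_conformalMatrix hc.mul_nonneg (.inr ⟨hw, hw'⟩)⟩

/-- The slack in the weak majorization of `|a - b|` by `c`. -/
noncomputable def lidskiiSlack (a b c : ℝ × ℝ) : ℝ :=
  min (c.1 - |a.1 - b.1|) (min (c.1 - |a.2 - b.2|) (c.1 + c.2 - (|a.1 - b.1| + |a.2 - b.2|)))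

lemma lidskiiSlack_comm (a b c : ℝ × ℝ) : lidskiiSlack a b c = lidskiiSlack b a c := by
  simp only [lidskiiSlack, abs_sub_comm b.1, abs_sub_comm b.2]

lemma lidskiiSlack_nonneg_iff {a b c : ℝ × ℝ} :
    0 ≤ lidskiiSlack a b c ↔ (a.1 ≤ b.1 + c.1 ∧ b.1 ≤ a.1 + c.1) ∧
      (a.2 ≤ b.2 + c.1 ∧ b.2 ≤ a.2 + c.1) ∧
      (a.1 + a.2 ≤ b.1 + b.2 + (c.1 + c.2) ∧ b.1 + b.2 ≤ a.1 + a.2 + (c.1 + c.2) ∧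
        a.1 - a.2 ≤ b.1 - b.2 + (c.1 + c.2) ∧ b.1 - b.2 ≤ a.1 - a.2 + (c.1 + c.2)) := by
  have e : |a.1 - b.1| + |a.2 - b.2| ≤ c.1 + c.2 ↔
      a.1 + a.2 ≤ b.1 + b.2 + (c.1 + c.2) ∧ b.1 + b.2 ≤ a.1 + a.2 + (c.1 + c.2) ∧
        a.1 - a.2 ≤ b.1 - b.2 + (c.1 + c.2) ∧ b.1 - b.2 ≤ a.1 - a.2 + (c.1 + c.2) := by
    constructor
    · intro h
      have h₁ := le_abs_self (a.1 - b.1)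
      have h₂ := neg_abs_le (a.1 - b.1)
      have h₃ := le_abs_self (a.2 - b.2)
      have h₄ := neg_abs_le (a.2 - b.2)
      refine ⟨?_, ?_, ?_, ?_⟩ <;> linarith
    · rintro ⟨h₁, h₂, h₃, h₄⟩
      rcases abs_cases (a.1 - b.1) with ⟨e, -⟩ | ⟨e, -⟩ <;>
        rcases abs_cases (a.2 - b.2) with ⟨e', -⟩ | ⟨e', -⟩ <;> rw [e, e'] <;> linarith
  simp only [lidskiiSlack, le_min_iff, sub_nonneg, e]
  rw [abs_sub_le_iff, abs_sub_le_iff]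
  simp only [sub_le_iff_le_add']

/-- The smallest slack in the Lidskii inequalities for the three pairs. -/
noncomputable def totalSlack (a b c : ℝ × ℝ) : ℝ :=
  min (lidskiiSlack a b c) (min (lidskiiSlack b c a) (lidskiiSlack c a b))

lemma totalSlack_rotate (a b c : ℝ × ℝ) : totalSlack b c a = totalSlack a b c := by
  simp only [totalSlack]
  rw [← min_assoc, min_comm]

lemma totalSlack_swap (a b c : ℝ × ℝ) : totalSlack b a c = totalSlack a b c := by
  simp only [totalSlack]
  rw [lidskiiSlack_comm b a, lidskiiSlack_comm a c, lidskiiSlack_comm c b,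
    min_comm (lidskiiSlack c a b)]

lemma continuous_totalSlack (b c : ℝ × ℝ) : Continuous fun a => totalSlack a b c := by
  unfold totalSlack lidskiiSlack
  fun_prop

lemma realizable_of_lidskiiSlack_eq_zero {a b c : ℝ × ℝ}
    (ha : IsSortedPair a) (hb : IsSortedPair b) (hc : IsSortedPair c)
    (h : 0 ≤ totalSlack a b c) (h₀ : lidskiiSlack a b c = 0) : Realizable a b c := by
  simp only [totalSlack, le_min_iff, lidskiiSlack_nonneg_iff] at h
  obtain ⟨⟨⟨_, _⟩, ⟨_, _⟩, _, _, _, _⟩, ⟨⟨_, _⟩, ⟨_, _⟩, _, _, _, _⟩,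
    ⟨⟨_, _⟩, ⟨_, _⟩, _, _, _, _⟩⟩ := h
  obtain ⟨_, _⟩ := id ha
  obtain ⟨_, _⟩ := id hb
  obtain ⟨_, _⟩ := id hc
  have h₁ : c.1 - |a.1 - b.1| = 0 ∨ c.1 - |a.2 - b.2| = 0 ∨
      c.1 + c.2 - (|a.1 - b.1| + |a.2 - b.2|) = 0 := by
    rw [lidskiiSlack] at h₀
    rcases min_choice (c.1 - |a.1 - b.1|) (min (c.1 - |a.2 - b.2|)
      (c.1 + c.2 - (|a.1 - b.1| + |a.2 - b.2|))) with e | e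
    · exact .inl (e ▸ h₀)
    · rw [e] at h₀
      rcases min_choice (c.1 - |a.2 - b.2|) (c.1 + c.2 - (|a.1 - b.1| + |a.2 - b.2|)) with e | e
      · exact .inr (.inl (e ▸ h₀))
      · exact .inr (.inr (e ▸ h₀))
  rcases h₁ with h₁ | h₁ | h₁
  · apply realizable_of_isTriangle <;> rcases abs_cases (a.1 - b.1) with ⟨e, -⟩ | ⟨e, -⟩ <;>
      refine ⟨?_, ?_, ?_⟩ <;> linarith
  · apply realizable_of_isTriangle_swap <;> rcases abs_cases (a.2 - b.2) with ⟨e, -⟩ | ⟨e, -⟩ <;>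
      refine ⟨?_, ?_, ?_⟩ <;> linarith
  · by_cases hs : 0 ≤ (a.1 - b.1) * (a.2 - b.2)
    · rw [← abs_add_eq_add_abs_iff _ _ |>.2 (mul_nonneg_iff.1 hs)] at h₁
      apply realizable_of_isTriangle_add_sub ha hb hc <;>
        rcases abs_cases (a.1 - b.1 + (a.2 - b.2)) with ⟨e, -⟩ | ⟨e, -⟩ <;>
        refine ⟨?_, ?_, ?_⟩ <;> linarith
    · have e : |a.1 - b.1 - (a.2 - b.2)| = |a.1 - b.1| + |a.2 - b.2| := by
        rw [sub_eq_add_neg (a.1 - b.1), ← abs_neg (a.2 - b.2)]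
        refine (abs_add_eq_add_abs_iff _ _).2 (mul_nonneg_iff.1 ?_)
        linarith
      rw [← e] at h₁
      apply realizable_of_isTriangle_add_sub_swap ha hb hc <;>
        rcases abs_cases (a.1 - b.1 - (a.2 - b.2)) with ⟨e, -⟩ | ⟨e, -⟩ <;>
        refine ⟨?_, ?_, ?_⟩ <;> linarith

lemma realizable_of_totalSlack_eq_zero {a b c : ℝ × ℝ}
    (ha : IsSortedPair a) (hb : IsSortedPair b) (hc : IsSortedPair c)
    (h : totalSlack a b c = 0) : Realizable a b c := by
  have h' := h
  rw [totalSlack] at h'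
  rcases min_choice (lidskiiSlack a b c) (min (lidskiiSlack b c a) (lidskiiSlack c a b))
    with e | e
  · exact realizable_of_lidskiiSlack_eq_zero ha hb hc h.ge (e ▸ h')
  rw [e] at h'
  rcases min_choice (lidskiiSlack b c a) (lidskiiSlack c a b) with e | e
  · exact (realizable_of_lidskiiSlack_eq_zero hb hc ha
      (by rw [totalSlack_rotate, h]) (e ▸ h')).rotate.rotate
  · exact (realizable_of_lidskiiSlack_eq_zero hc ha hb
      (by rw [totalSlack_rotate, totalSlack_rotate, h]) (e ▸ h')).rotate

section

variable {E F : Type*} [NormedAddCommGroup E] [InnerProductSpace ℂ E] [NormedAddCommGroup F]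
  [InnerProductSpace ℂ F]

/-- `T` has a singular value decomposition with singular values `s.1` and `s.2`. -/
def HasSVD (T : E →ₗ[ℂ] F) (s : ℝ × ℝ) : Prop :=
  ∃ v : OrthonormalBasis (Fin 2) ℂ E, ∃ u : Fin 2 → F, Orthonormal ℂ u ∧
    T (v 0) = (s.1 : ℂ) • u 0 ∧ T (v 1) = (s.2 : ℂ) • u 1

lemma Orthonormal.neg_comp {u : Fin 2 → F} (hu : Orthonormal ℂ u) :
    Orthonormal ℂ fun i => -u i :=
  ⟨fun i => by rw [norm_neg, hu.1 i], fun i j hij => by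
    simpa using hu.2 hij⟩

lemma HasSVD.neg {T : E →ₗ[ℂ] F} {s : ℝ × ℝ} (h : HasSVD T s) : HasSVD (-T) s := by
  obtain ⟨v, u, hu, h₀, h₁⟩ := h
  exact ⟨v, fun i => -u i, hu.neg_comp, by simp [h₀], by simp [h₁]⟩

lemma Orthonormal.norm_add_sq_fin_two {u : Fin 2 → F} (hu : Orthonormal ℂ u) (z w : ℂ) :
    ‖z • u 0 + w • u 1‖ ^ 2 = ‖z‖ ^ 2 + ‖w‖ ^ 2 := by
  have h : inner ℂ (u 0) (u 1) = 0 := hu.2 (by decide)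
  have := norm_add_sq_eq_norm_sq_add_norm_sq_of_inner_eq_zero (𝕜 := ℂ) (z • u 0) (w • u 1)
    (by rw [inner_smul_left, inner_smul_right, h]; simp)
  simp only [← sq, norm_smul, hu.1, mul_one] at this
  exact this

lemma HasSVD.norm_apply_sq {T : E →ₗ[ℂ] F} {s : ℝ × ℝ} (h : HasSVD T s) (x : E) :
    ∃ r t : ℝ, 0 ≤ r ∧ 0 ≤ t ∧ ‖x‖ ^ 2 = r + t ∧ ‖T x‖ ^ 2 = s.1 ^ 2 * r + s.2 ^ 2 * t := by
  obtain ⟨v, u, hu, h₀, h₁⟩ := h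
  refine ⟨‖inner ℂ (v 0) x‖ ^ 2, ‖inner ℂ (v 1) x‖ ^ 2, by positivity, by positivity, ?_, ?_⟩
  · rw [← v.sum_sq_norm_inner_right x, Fin.sum_univ_two]
  · conv_lhs => rw [← v.sum_repr' x, Fin.sum_univ_two, map_add, map_smul, map_smul, h₀, h₁,
      smul_smul, smul_smul, hu.norm_add_sq_fin_two]
    simp only [norm_mul, Complex.norm_real, mul_pow, Real.norm_eq_abs, sq_abs]
    ring

lemma HasSVD.norm_apply_le {T : E →ₗ[ℂ] F} {s : ℝ × ℝ} (h : HasSVD T s) (hs : IsSortedPair s)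
    (x : E) : ‖T x‖ ≤ s.1 * ‖x‖ := by
  obtain ⟨r, t, hr, ht, hx, hT⟩ := h.norm_apply_sq x
  refine (sq_le_sq₀ (norm_nonneg _) (mul_nonneg (hs.1.trans hs.2) (norm_nonneg _))).1 ?_
  rw [mul_pow, hx, hT]
  nlinarith [mul_le_mul_of_nonneg_right (pow_le_pow_left₀ hs.1 hs.2 2) ht]

lemma HasSVD.le_norm_apply {T : E →ₗ[ℂ] F} {s : ℝ × ℝ} (h : HasSVD T s) (hs : IsSortedPair s)
    (x : E) : s.2 * ‖x‖ ≤ ‖T x‖ := by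
  obtain ⟨r, t, hr, ht, hx, hT⟩ := h.norm_apply_sq x
  refine (sq_le_sq₀ (mul_nonneg hs.1 (norm_nonneg _)) (norm_nonneg _)).1 ?_
  rw [mul_pow, hx, hT]
  nlinarith [mul_le_mul_of_nonneg_right (pow_le_pow_left₀ hs.1 hs.2 2) hr]

lemma re_mul_add_mul_le (p q r t : ℂ) :
    (p * q + r * t).re ≤ (‖p‖ ^ 2 + ‖r‖ ^ 2 + (‖q‖ ^ 2 + ‖t‖ ^ 2)) / 2 := by
  have h₁ := (Complex.re_le_norm (p * q)).trans_eq (norm_mul p q)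
  have h₂ := (Complex.re_le_norm (r * t)).trans_eq (norm_mul r t)
  rw [Complex.add_re]
  nlinarith [sq_nonneg (‖p‖ - ‖q‖), sq_nonneg (‖r‖ - ‖t‖)]

lemma Orthonormal.sum_sq_inner_le {x : Fin 2 → F} (hx : Orthonormal ℂ x) {y : F} (hy : ‖y‖ = 1) :
    ‖inner ℂ (x 0) y‖ ^ 2 + ‖inner ℂ (x 1) y‖ ^ 2 ≤ 1 := by
  have := hx.sum_inner_products_le (s := Finset.univ) y
  rwa [Fin.sum_univ_two, hy, one_pow] at this

/-- Cauchy–Schwarz and Bessel for a rank one operator. -/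
lemma re_inner_rank_one_le {x : Fin 2 → F} {w : Fin 2 → E} (hx : Orthonormal ℂ x)
    (hw : Orthonormal ℂ w) {y : F} {z : E} (hy : ‖y‖ = 1) (hz : ‖z‖ = 1) :
    (inner ℂ (x 0) (inner ℂ z (w 0) • y) + inner ℂ (x 1) (inner ℂ z (w 1) • y)).re ≤ 1 := by
  rw [inner_smul_right, inner_smul_right]
  have h₁ := hx.sum_sq_inner_le hy
  have h₂ := hw.sum_sq_inner_le hz
  rw [norm_inner_symm, norm_inner_symm (w 1)] at h₂
  exact (re_mul_add_mul_le _ _ _ _).trans (by linarith)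

lemma HasSVD.re_sum_inner_le {T : E →ₗ[ℂ] F} {s : ℝ × ℝ} (h : HasSVD T s) (hs : IsSortedPair s)
    {x : Fin 2 → F} {w : Fin 2 → E} (hx : Orthonormal ℂ x) (hw : Orthonormal ℂ w) :
    (inner ℂ (x 0) (T (w 0)) + inner ℂ (x 1) (T (w 1))).re ≤ s.1 + s.2 := by
  obtain ⟨v, u, hu, h₀, h₁⟩ := h
  have e : ∀ y : E, T y = (s.1 : ℂ) • (inner ℂ (v 0) y • u 0) +
      (s.2 : ℂ) • (inner ℂ (v 1) y • u 1) := by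
    intro y
    conv_lhs => rw [← v.sum_repr' y, Fin.sum_univ_two, map_add, map_smul, map_smul, h₀, h₁,
      smul_comm, smul_comm (inner ℂ (v 1) y)]
  have k₀ := re_inner_rank_one_le hx hw (hu.1 0) (v.orthonormal.1 0)
  have k₁ := re_inner_rank_one_le hx hw (hu.1 1) (v.orthonormal.1 1)
  rw [Complex.add_re] at k₀ k₁ ⊢
  rw [e, e, inner_add_right, inner_add_right, Complex.add_re, Complex.add_re]
  simp only [inner_smul_right _ _ (s.1 : ℂ), inner_smul_right _ _ (s.2 : ℂ), Complex.re_ofReal_mul]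
  nlinarith [mul_le_mul_of_nonneg_left k₀ (hs.1.trans hs.2), mul_le_mul_of_nonneg_left k₁ hs.1]

/-- For an orthonormal pair `w`, a unit vector `x` admits an orthogonal unit vector `y` whose
overlap with `w 1` dominates that of `x` with `w 0`. -/
lemma Orthonormal.exists_orthogonal_le {u w : Fin 2 → F} (hu : Orthonormal ℂ u)
    (hw : Orthonormal ℂ w) : ∃ y : F, Orthonormal ℂ ![u 0, -y] ∧
      (inner ℂ (u 0) (w 0)).re ≤ (inner ℂ y (w 1)).re := by
  set r : F := w 1 - inner ℂ (u 0) (w 1) • u 0 with hr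
  have hxx : inner ℂ (u 0) (u 0) = 1 := by
    rw [inner_self_eq_norm_sq_to_K, hu.1]; simp
  have hxr : inner ℂ (u 0) r = 0 := by
    rw [hr, inner_sub_right, inner_smul_right, hxx, mul_one, sub_self]
  have hn : ‖w 1‖ ^ 2 = ‖inner ℂ (u 0) (w 1)‖ ^ 2 + ‖r‖ ^ 2 := by
    have := norm_add_sq_eq_norm_sq_add_norm_sq_of_inner_eq_zero (𝕜 := ℂ)
      (inner ℂ (u 0) (w 1) • u 0) r (by rw [inner_smul_left, hxr, mul_zero])
    rw [hr, add_sub_cancel, ← hr, norm_smul, hu.1, mul_one] at this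
    simpa only [sq] using this
  have hB := hw.sum_sq_inner_le (hu.1 0)
  rw [norm_inner_symm, norm_inner_symm (w 1)] at hB
  rw [hw.1, one_pow] at hn
  have hle : (inner ℂ (u 0) (w 0)).re ≤ ‖r‖ :=
    (Complex.re_le_norm _).trans ((sq_le_sq₀ (norm_nonneg _) (norm_nonneg _)).1 (by linarith))
  have hon : ∀ y : F, ‖y‖ = 1 → inner ℂ (u 0) y = 0 → Orthonormal ℂ ![u 0, -y] := by
    intro y hy hxy
    rw [orthonormal_vecCons_iff]
    refine ⟨hu.1 0, by simpa using hxy, ?_, ?_⟩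
    · simpa using hy
    · exact fun i j hij => absurd (Subsingleton.elim i j) hij
  by_cases h0 : r = 0
  · refine ⟨u 1, hon _ (hu.1 1) (hu.2 (by decide)), ?_⟩
    have : w 1 = inner ℂ (u 0) (w 1) • u 0 := sub_eq_zero.1 h0
    rw [this, inner_smul_right, hu.2 (show (1 : Fin 2) ≠ 0 by decide)]
    simpa [h0] using hle
  · have hr0 : ‖r‖ ≠ 0 := norm_ne_zero_iff.2 h0
    refine ⟨((‖r‖⁻¹ : ℝ) : ℂ) • r, hon _ ?_ ?_, ?_⟩
    · rw [norm_smul, Complex.norm_real, norm_inv, norm_norm, inv_mul_cancel₀ hr0]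
    · rw [inner_smul_right, hxr, mul_zero]
    · have hrw : inner ℂ r (w 1) = ((‖r‖ ^ 2 : ℝ) : ℂ) := by
        have : w 1 = inner ℂ (u 0) (w 1) • u 0 + r := by rw [hr, add_sub_cancel]
        rw [this, inner_add_right, inner_smul_right, inner_eq_zero_symm.1 hxr, mul_zero, zero_add,
          inner_self_eq_norm_sq_to_K]
        simp
      rw [inner_smul_left, Complex.conj_ofReal, hrw, ← Complex.ofReal_mul, Complex.ofReal_re]
      convert hle using 1
      field_simp

lemma HasSVD.exists_isometry {T : E →ₗ[ℂ] F} {s : ℝ × ℝ} (h : HasSVD T s) :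
    ∃ W : E →ₗᵢ[ℂ] F, ∃ z : E, ∃ y : F, ‖z‖ = 1 ∧ ‖y‖ = 1 ∧
      ∀ x, T x = (s.2 : ℂ) • W x + ((s.1 - s.2 : ℝ) : ℂ) • (inner ℂ z x • y) := by
  obtain ⟨v, u, hu, h₀, h₁⟩ := h
  have e : ∀ i, v.toBasis.constr ℂ u (v i) = u i := fun i => by
    rw [← v.coe_toBasis, Module.Basis.constr_basis]
  refine ⟨(v.toBasis.constr ℂ u).isometryOfOrthonormal (v := v.toBasis)
    (by rw [v.coe_toBasis]; exact v.orthonormal) ?_, v 0, u 0, v.orthonormal.1 0, hu.1 0, ?_⟩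
  · convert hu using 1
    ext i
    rw [Function.comp_apply, Module.Basis.constr_basis]
  · intro x
    rw [LinearMap.coe_isometryOfOrthonormal]
    conv_lhs => rw [← v.sum_repr' x, Fin.sum_univ_two, map_add, map_smul, map_smul, h₀, h₁]
    conv_rhs => rw [← v.sum_repr' x, Fin.sum_univ_two, map_add, map_smul, map_smul, e, e,
      ← Fin.sum_univ_two (f := fun i => inner ℂ (v i) x • v i), v.sum_repr']
    push_cast
    module

lemma lidskii_of_hasSVD {S T R : E →ₗ[ℂ] F} {a b c : ℝ × ℝ} (hS : HasSVD S a) (hT : HasSVD T b)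
    (hR : HasSVD R c) (ha : IsSortedPair a) (hb : IsSortedPair b) (hc : IsSortedPair c)
    (h : S = T + R) : a.1 ≤ b.1 + c.1 ∧ a.2 ≤ b.2 + c.1 ∧ a.1 + a.2 ≤ b.1 + b.2 + (c.1 + c.2) ∧
      a.1 - a.2 ≤ b.1 - b.2 + (c.1 + c.2) := by
  have hSx : ∀ x, S x = T x + R x := fun x => by rw [h, LinearMap.add_apply]
  obtain ⟨v, u, hu, h₀, h₁⟩ := id hS
  have ha1 := ha.1.trans ha.2
  have i₀ : inner ℂ (u 0) (S (v 0)) = a.1 := by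
    rw [h₀, inner_smul_right, inner_self_eq_norm_sq_to_K, hu.1]; simp
  have i₁ : inner ℂ (u 1) (S (v 1)) = a.2 := by
    rw [h₁, inner_smul_right, inner_self_eq_norm_sq_to_K, hu.1]; simp
  refine ⟨?_, ?_, ?_, ?_⟩
  · calc a.1 = ‖S (v 0)‖ := by
          rw [h₀, norm_smul, hu.1, mul_one, Complex.norm_real, Real.norm_of_nonneg ha1]
      _ ≤ ‖T (v 0)‖ + ‖R (v 0)‖ := by rw [hSx]; exact norm_add_le _ _
      _ ≤ b.1 + c.1 := by
          have := hT.norm_apply_le hb (v 0)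
          have := hR.norm_apply_le hc (v 0)
          simp only [v.orthonormal.1, mul_one] at *
          linarith
  · obtain ⟨v', u', hu', -, h₁'⟩ := id hT
    calc a.2 = a.2 * ‖v' 1‖ := by rw [v'.orthonormal.1, mul_one]
      _ ≤ ‖S (v' 1)‖ := hS.le_norm_apply ha _
      _ ≤ ‖T (v' 1)‖ + ‖R (v' 1)‖ := by rw [hSx]; exact norm_add_le _ _
      _ ≤ b.2 + c.1 := by
          have := hR.norm_apply_le hc (v' 1)
          rw [v'.orthonormal.1, mul_one] at this
          rw [h₁', norm_smul, hu'.1, mul_one, Complex.norm_real, Real.norm_of_nonneg hb.1]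
          linarith
  · have k₁ := hT.re_sum_inner_le hb hu v.orthonormal
    have k₂ := hR.re_sum_inner_le hc hu v.orthonormal
    rw [hSx, inner_add_right] at i₀ i₁
    have j₀ := congrArg Complex.re i₀
    have j₁ := congrArg Complex.re i₁
    simp only [Complex.add_re, Complex.ofReal_re] at *
    linarith
  · obtain ⟨W, z, y, hz, hy, hW⟩ := hT.exists_isometry
    obtain ⟨x, hx, hle⟩ := hu.exists_orthogonal_le (v.orthonormal.comp_linearIsometry W)
    have k₁ := re_inner_rank_one_le hx v.orthonormal hy hz
    have k₂ := hR.re_sum_inner_le hc hx v.orthonormal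
    have hx1 : ‖x‖ = 1 := by simpa using hx.1 1
    have k₃ : (inner ℂ x (S (v 1))).re ≤ a.2 := by
      refine (Complex.re_le_norm _).trans ((norm_inner_le_norm _ _).trans_eq ?_)
      rw [hx1, h₁, norm_smul, hu.1, Complex.norm_real, Real.norm_of_nonneg ha.1]
      ring
    have j₀ := congrArg Complex.re i₀
    simp only [hSx, hW, inner_add_right, inner_smul_right _ _ (b.2 : ℂ),
      inner_smul_right _ _ ((b.1 - b.2 : ℝ) : ℂ), Complex.add_re, Complex.re_ofReal_mul,
      Complex.ofReal_re, Matrix.cons_val_zero, Matrix.cons_val_one, Matrix.cons_val_fin_one,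
      inner_neg_left, Complex.neg_re, Function.comp_apply] at *
    nlinarith [mul_le_mul_of_nonneg_left hle hb.1,
      mul_le_mul_of_nonneg_left k₁ (sub_nonneg.2 hb.2)]

lemma lidskiiSlack_nonneg_of_hasSVD {S T R : E →ₗ[ℂ] F} {a b c : ℝ × ℝ} (hS : HasSVD S a)
    (hT : HasSVD T b) (hR : HasSVD R c) (ha : IsSortedPair a) (hb : IsSortedPair b)
    (hc : IsSortedPair c) (h : S + T + R = 0) : 0 ≤ lidskiiSlack a b c := by
  obtain ⟨_, _, _, _⟩ := lidskii_of_hasSVD hS hT.neg hR.neg ha hb hc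
    (by rw [← sub_eq_zero, ← h]; abel)
  obtain ⟨_, _, _, _⟩ := lidskii_of_hasSVD hT hS.neg hR.neg hb ha hc
    (by rw [← sub_eq_zero, ← h]; abel)
  exact lidskiiSlack_nonneg_iff.2 ⟨⟨‹_›, ‹_›⟩, ⟨‹_›, ‹_›⟩, ‹_›, ‹_›, ‹_›, ‹_›⟩

/-- The Lidskii inequalities hold for maps with zero sum. -/
theorem totalSlack_nonneg_of_hasSVD {S T R : E →ₗ[ℂ] F} {a b c : ℝ × ℝ} (hS : HasSVD S a)
    (hT : HasSVD T b) (hR : HasSVD R c) (ha : IsSortedPair a) (hb : IsSortedPair b)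
    (hc : IsSortedPair c) (h : S + T + R = 0) : 0 ≤ totalSlack a b c :=
  le_min (lidskiiSlack_nonneg_of_hasSVD hS hT hR ha hb hc h)
    (le_min (lidskiiSlack_nonneg_of_hasSVD hT hR hS hb hc ha (by rw [← h]; abel))
      (lidskiiSlack_nonneg_of_hasSVD hR hS hT hc ha hb (by rw [← h]; abel)))

end

lemma hasSingularPair_iff_trace {M : Matrix (Fin 2) (Fin 2) ℂ} {s : ℝ × ℝ} :
    HasSingularPair M s ↔ (Mᴴ * M).trace = ((s.1 ^ 2 + s.2 ^ 2 : ℝ) : ℂ) ∧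
      ‖M.det‖ = s.1 * s.2 := by
  have e : (Mᴴ * M).trace =
      ((‖M 0 0‖ ^ 2 + ‖M 0 1‖ ^ 2 + ‖M 1 0‖ ^ 2 + ‖M 1 1‖ ^ 2 : ℝ) : ℂ) := by
    simp [Matrix.trace_fin_two, Matrix.mul_apply, Fin.sum_univ_two, Complex.conj_mul']
    ring
  rw [HasSingularPair, e, Complex.ofReal_inj]

lemma HasSingularPair.unitary_mul_mul {M U V : Matrix (Fin 2) (Fin 2) ℂ} {s : ℝ × ℝ}
    (h : HasSingularPair M s) (hU : U ∈ Matrix.unitaryGroup (Fin 2) ℂ)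
    (hV : V ∈ Matrix.unitaryGroup (Fin 2) ℂ) : HasSingularPair (star U * M * V) s := by
  rw [hasSingularPair_iff_trace] at *
  have hUU : U * Uᴴ = 1 := Matrix.mem_unitaryGroup_iff.1 hU
  have hVV : V * Vᴴ = 1 := Matrix.mem_unitaryGroup_iff.1 hV
  constructor
  · rw [← h.1, Matrix.star_eq_conjTranspose]
    simp only [Matrix.conjTranspose_mul, Matrix.conjTranspose_conjTranspose]
    rw [Matrix.mul_assoc, Matrix.trace_mul_comm]
    congr 1
    calc _ = Mᴴ * (U * Uᴴ) * M * (V * Vᴴ) := by simp only [Matrix.mul_assoc]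
      _ = _ := by rw [hUU, hVV, Matrix.mul_one, Matrix.mul_one]
  · have hdet : ∀ W ∈ Matrix.unitaryGroup (Fin 2) ℂ, ‖W.det‖ = 1 := fun W hW =>
      CStarRing.norm_of_mem_unitary (Matrix.det_of_mem_unitary hW)
    rw [Matrix.det_mul, Matrix.det_mul, norm_mul, norm_mul, hdet V hV,
      hdet _ (Unitary.star_mem hU), h.2]
    ring

/-- The level of the linear form that fixes the Frobenius norm of the sum. -/

lemma hasSVD_of_pairwise_orthogonal {E F : Type*} [NormedAddCommGroup E] [InnerProductSpace ℂ E]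
    [NormedAddCommGroup F] [InnerProductSpace ℂ F] [FiniteDimensional ℂ F]
    (hF : 2 ≤ Module.finrank ℂ F) (T : E →ₗ[ℂ] F) (v : OrthonormalBasis (Fin 2) ℂ E)
    (h : inner ℂ (T (v 0)) (T (v 1)) = 0) : HasSVD T (‖T (v 0)‖, ‖T (v 1)‖) := by
  set f : Fin (Module.finrank ℂ F) → F := Function.extend (Fin.castLE hF) (T ∘ v) 0 with hf
  have hinj : Function.Injective (Fin.castLE hF) := Fin.castLE_injective hF
  have hfv : ∀ i, f (Fin.castLE hF i) = T (v i) := fun i => hinj.extend_apply _ _ i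
  have ho : Pairwise fun i j => inner ℂ (f i) (f j) = 0 := by
    intro i j hij
    by_cases hi : ∃ k, Fin.castLE hF k = i
    · by_cases hj : ∃ l, Fin.castLE hF l = j
      · obtain ⟨k, rfl⟩ := hi
        obtain ⟨l, rfl⟩ := hj
        rw [hfv, hfv]
        fin_cases k <;> fin_cases l
        · exact absurd rfl hij
        · exact h
        · exact inner_eq_zero_symm.1 h
        · exact absurd rfl hij
      · rw [hf, Function.extend_apply' _ _ j hj, Pi.zero_apply, inner_zero_right]
    · rw [hf, Function.extend_apply' _ _ i hi, Pi.zero_apply, inner_zero_left]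
  set g := InnerProductSpace.gramSchmidtOrthonormalBasis (𝕜 := ℂ) (by simp) f with hg
  have key : ∀ i, T (v i) = (‖T (v i)‖ : ℂ) • g (Fin.castLE hF i) := by
    intro i
    by_cases h0 : T (v i) = 0
    · simp [h0]
    · rw [← hfv] at h0 ⊢
      have hn : ((‖f (Fin.castLE hF i)‖ : ℝ) : ℂ) ≠ 0 := by simpa using h0
      rw [hg, InnerProductSpace.gramSchmidtOrthonormalBasis_apply_of_orthogonal _ ho h0]
      exact (smul_inv_smul₀ hn _).symm
  exact ⟨v, g ∘ Fin.castLE hF, g.orthonormal.comp _ hinj, key 0, key 1⟩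

section

variable {p : ℕ}

/-- The pair of singular values of a matrix with two columns. -/
noncomputable def singularPair (A : Matrix (Fin p) (Fin 2) ℂ) : ℝ × ℝ :=
  (singularValues A 0, singularValues A 1)

lemma eigsDesc_nonneg (A : Matrix (Fin p) (Fin 2) ℂ) (i : Fin 2) :
    0 ≤ eigsDesc (isHermitian_conjTranspose_mul_self A) i :=
  eigenvalues_conjTranspose_mul_self_nonneg A _

lemma isSortedPair_singularPair (A : Matrix (Fin p) (Fin 2) ℂ) :
    IsSortedPair (singularPair A) :=
  ⟨Real.sqrt_nonneg _, Real.sqrt_le_sqrt (Tuple.monotone_sort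
    (isHermitian_conjTranspose_mul_self A).eigenvalues (Fin.rev_le_rev.2 (Fin.zero_le 1)))⟩

lemma hasSVD_singularPair (hp : 2 ≤ p) (A : Matrix (Fin p) (Fin 2) ℂ) :
    HasSVD (toEuclideanLin A) (singularPair A) := by
  have hA := isHermitian_conjTranspose_mul_self A
  set σ : Fin 2 ≃ Fin 2 := Fin.revPerm.trans (Tuple.sort hA.eigenvalues)
  set v := hA.eigenvectorBasis.reindex σ.symm with hv
  have hev : ∀ i, toEuclideanLin (Aᴴ * A) (v i) = ((eigsDesc hA i : ℝ) : ℂ) • v i := by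
    intro i
    ext k
    rw [hv, OrthonormalBasis.reindex_apply, Equiv.symm_symm]
    exact congrFun (hA.mulVec_eigenvectorBasis (σ i)) k
  have hinner : ∀ i j, inner ℂ (toEuclideanLin A (v i)) (toEuclideanLin A (v j)) =
      ((eigsDesc hA j : ℝ) : ℂ) * inner ℂ (v i) (v j) := by
    intro i j
    rw [← inner_smul_right, ← hev, ← LinearMap.adjoint_inner_right,
      ← toEuclideanLin_conjTranspose_eq_adjoint]
    congr 1
    ext1
    simp
  have hnorm : ∀ i, ‖toEuclideanLin A (v i)‖ = singularValues A i := by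
    intro i
    refine (Real.sqrt_eq_iff_eq_sq (eigsDesc_nonneg A i) (norm_nonneg _)).2 ?_ |>.symm
    have := hinner i i
    rw [inner_self_eq_norm_sq_to_K, inner_self_eq_norm_sq_to_K, v.orthonormal.1 i] at this
    apply Complex.ofReal_injective
    simpa using this.symm
  rw [singularPair, ← hnorm, ← hnorm]
  refine hasSVD_of_pairwise_orthogonal (by simpa using hp) _ v ?_
  rw [hinner, v.orthonormal.2 (by decide), mul_zero]

lemma singularValues_congr {p' q : ℕ} {A : Matrix (Fin p) (Fin q) ℂ}
    {B : Matrix (Fin p') (Fin q) ℂ} (h : Aᴴ * A = Bᴴ * B) : singularValues A = singularValues B := by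
  unfold singularValues
  congr!

end

lemma hasSingularPair_singularPair (M : Matrix (Fin 2) (Fin 2) ℂ) :
    HasSingularPair M (singularPair M) := by
  have hM := isHermitian_conjTranspose_mul_self M
  set σ : Fin 2 ≃ Fin 2 := Fin.revPerm.trans (Tuple.sort hM.eigenvalues)
  have hsq : ∀ i, singularValues M i ^ 2 = hM.eigenvalues (σ i) := fun i =>
    Real.sq_sqrt (eigsDesc_nonneg M i)
  rw [hasSingularPair_iff_trace]
  constructor
  · rw [hM.trace_eq_sum_eigenvalues, singularPair, hsq, hsq, ← Fin.sum_univ_two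
      (f := fun i => hM.eigenvalues (σ i)), Equiv.sum_comp σ hM.eigenvalues]
    simp
  · refine (sq_eq_sq₀ (norm_nonneg _) (isSortedPair_singularPair M).mul_nonneg).1 ?_
    have h := hM.det_eq_prod_eigenvalues
    rw [← Equiv.prod_comp σ, Fin.prod_univ_two, ← hsq, ← hsq, det_mul, det_conjTranspose,
      Complex.star_def, Complex.conj_mul'] at h
    rw [mul_pow, singularPair]
    exact Complex.ofReal_injective (by simpa using h)

lemma HasSingularPair.unique {M : Matrix (Fin 2) (Fin 2) ℂ} {s t : ℝ × ℝ} (hs : IsSortedPair s)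
    (ht : IsSortedPair t) (h : HasSingularPair M s) (h' : HasSingularPair M t) : s = t := by
  have e₁ := h.1.symm.trans h'.1
  have e₂ := h.2.symm.trans h'.2
  have hadd : s.1 + s.2 = t.1 + t.2 :=
    (sq_eq_sq₀ (by linarith [hs.1, hs.2]) (by linarith [ht.1, ht.2])).1 (by linarith)
  have hsub : s.1 - s.2 = t.1 - t.2 :=
    (sq_eq_sq₀ (sub_nonneg.2 hs.2) (sub_nonneg.2 ht.2)).1 (by linarith)
  ext <;> linarith

lemma of_mem_unitaryGroup {u : Fin 2 → EuclideanSpace ℂ (Fin 2)} (hu : Orthonormal ℂ u) :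
    (of fun i j => u j i) ∈ Matrix.unitaryGroup (Fin 2) ℂ := by
  rw [mem_unitaryGroup_iff']
  ext i j
  rw [star_eq_conjTranspose, mul_apply, one_apply, ← orthonormal_iff_ite.1 hu i j,
    PiLp.inner_apply]
  simp [mul_comm]

lemma HasSingularPair.exists_unitary {M : Matrix (Fin 2) (Fin 2) ℂ} {s : ℝ × ℝ}
    (hs : IsSortedPair s) (h : HasSingularPair M s) :
    ∃ U ∈ Matrix.unitaryGroup (Fin 2) ℂ, ∃ V ∈ Matrix.unitaryGroup (Fin 2) ℂ,
      star U * M * V = !![(s.1 : ℂ), 0; 0, (s.2 : ℂ)] := by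
  rw [h.unique hs (isSortedPair_singularPair M) (hasSingularPair_singularPair M)]
  obtain ⟨v, u, hu, h₀, h₁⟩ := hasSVD_singularPair le_rfl M
  refine ⟨_, of_mem_unitaryGroup hu, _, of_mem_unitaryGroup v.orthonormal, ?_⟩
  have e : M * (of fun i j => v j i) = (of fun i j => u j i) *
      !![((singularPair M).1 : ℂ), 0; 0, ((singularPair M).2 : ℂ)] := by
    ext i j
    have k₀ := congrArg (fun x => x i) h₀
    have k₁ := congrArg (fun x => x i) h₁
    simp [mulVec, dotProduct] at k₀ k₁
    fin_cases j <;> simp [mul_apply, k₀, k₁, mul_comm]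
  rw [Matrix.mul_assoc, e, ← Matrix.mul_assoc, mem_unitaryGroup_iff'.1 (of_mem_unitaryGroup hu),
    Matrix.one_mul]

lemma exists_mul_eq_and_sq_add_sq_eq {ζ : ℂ} {r : ℝ} (h : 2 * ‖ζ‖ ≤ r) :
    ∃ z w : ℂ, z * w = ζ ∧ ‖z‖ ^ 2 + ‖w‖ ^ 2 = r := by
  have hζ := norm_nonneg ζ
  have h₁ := Real.sq_sqrt (show 0 ≤ r + 2 * ‖ζ‖ by linarith)
  have h₂ := Real.sq_sqrt (show 0 ≤ r - 2 * ‖ζ‖ by linarith)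
  set p := √(r + 2 * ‖ζ‖)
  set q := √(r - 2 * ‖ζ‖)
  have hpq : (p + q) / 2 * ((p - q) / 2) = ‖ζ‖ := by linarith
  refine ⟨((p + q) / 2 : ℝ) * Complex.exp (ζ.arg * Complex.I), ((p - q) / 2 : ℝ), ?_, ?_⟩
  · rw [mul_right_comm, ← Complex.ofReal_mul, hpq, Complex.norm_mul_exp_arg_mul_I]
  · rw [norm_mul, Complex.norm_exp_ofReal_mul_I, mul_one, Complex.norm_real, Complex.norm_real,
      Real.norm_eq_abs, Real.norm_eq_abs, sq_abs, sq_abs]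
    linarith

/-- The diagonals of the `2 × 2` matrices with singular values `c` and determinant `c.1 * c.2`. -/
def diagonalRange (c : ℝ × ℝ) : Set (ℂ × ℂ) :=
  {p | ‖p.1‖ ^ 2 + ‖p.2‖ ^ 2 + 2 * ‖p.1 * p.2 - (c.1 * c.2 : ℝ)‖ ≤ c.1 ^ 2 + c.2 ^ 2}

lemma norm_add_mul_conj_sq (ω x y : ℂ) (hω : ‖ω‖ = 1) :
    ‖x + ω * star y‖ ^ 2 = ‖x‖ ^ 2 + ‖y‖ ^ 2 + 2 * (star ω * (x * y)).re := by
  have h : ‖ω * star y‖ = ‖y‖ := by rw [norm_mul, hω, one_mul, norm_star]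
  rw [← h, Complex.sq_norm, Complex.sq_norm, Complex.sq_norm, Complex.normSq_add]
  simp
  ring

lemma mem_diagonalRange_iff {c : ℝ × ℝ} {p : ℂ × ℂ} :
    p ∈ diagonalRange c ↔ ∀ ω : ℂ, ‖ω‖ = 1 → ‖p.1 + ω * star p.2‖ ≤ ‖(c.1 : ℂ) + ω * c.2‖ := by
  have key : ∀ ω : ℂ, ‖ω‖ = 1 → (‖p.1 + ω * star p.2‖ ≤ ‖(c.1 : ℂ) + ω * c.2‖ ↔
      ‖p.1‖ ^ 2 + ‖p.2‖ ^ 2 + 2 * (star ω * (p.1 * p.2 - (c.1 * c.2 : ℝ))).re ≤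
        c.1 ^ 2 + c.2 ^ 2) := by
    intro ω hω
    have e := norm_add_mul_conj_sq ω c.1 c.2 hω
    rw [Complex.norm_real, Complex.norm_real, Real.norm_eq_abs, Real.norm_eq_abs, sq_abs, sq_abs,
      show star (c.2 : ℂ) = c.2 from Complex.conj_ofReal _] at e
    rw [← sq_le_sq₀ (norm_nonneg _) (norm_nonneg _), norm_add_mul_conj_sq _ _ _ hω, e, mul_sub,
      Complex.sub_re, Complex.ofReal_mul]
    constructor <;> intro h <;> linarith
  constructor
  · intro h ω hω
    rw [key ω hω]
    have := Complex.re_le_norm (star ω * (p.1 * p.2 - (c.1 * c.2 : ℝ)))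
    rw [norm_mul, norm_star, hω, one_mul] at this
    simp only [diagonalRange, Set.mem_ofPred_eq] at h
    linarith
  · intro h
    set ζ := p.1 * p.2 - (c.1 * c.2 : ℝ) with hζ
    have hω := Complex.norm_exp_ofReal_mul_I ζ.arg
    have h' := (key _ hω).1 (h _ hω)
    have e : star (Complex.exp (ζ.arg * Complex.I)) * ζ = ‖ζ‖ := by
      nth_rewrite 2 [← Complex.norm_mul_exp_arg_mul_I ζ]
      rw [mul_left_comm, Complex.star_def, Complex.conj_mul', hω]
      simp
    rw [e, Complex.ofReal_re] at h'
    exact h'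

lemma convex_diagonalRange (c : ℝ × ℝ) : Convex ℝ (diagonalRange c) := by
  intro p hp q hq s t hs ht hst
  rw [mem_diagonalRange_iff] at *
  intro ω hω
  have e : (s • p + t • q).1 + ω * star (s • p + t • q).2 =
      s • (p.1 + ω * star p.2) + t • (q.1 + ω * star q.2) := by
    simp
    ring
  rw [e]
  refine (norm_add_le _ _).trans ?_
  rw [norm_smul, norm_smul, Real.norm_of_nonneg hs, Real.norm_of_nonneg ht]
  calc _ ≤ s * ‖(c.1 : ℂ) + ω * c.2‖ + t * ‖(c.1 : ℂ) + ω * c.2‖ := by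
        gcongr
        exacts [hp ω hω, hq ω hω]
    _ = _ := by rw [← add_mul, hst, one_mul]

/-- The point of the closed right unit semicircle with imaginary part `t`. -/
noncomputable def semicirclePoint (t : ℝ) : ℂ := ⟨√(1 - t ^ 2), t⟩

lemma continuous_semicirclePoint : Continuous semicirclePoint := by
  have : semicirclePoint = fun t : ℝ => ((√(1 - t ^ 2) : ℝ) : ℂ) + t * Complex.I := by
    ext t
    apply Complex.ext <;> simp [semicirclePoint]
  rw [this]
  fun_prop

lemma semicirclePoint_re_sq {t : ℝ} (ht : t ∈ Set.Icc (-1 : ℝ) 1) :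
    √(1 - t ^ 2) ^ 2 = 1 - t ^ 2 :=
  Real.sq_sqrt (by nlinarith [ht.1, ht.2])

lemma norm_semicirclePoint {t : ℝ} (ht : t ∈ Set.Icc (-1 : ℝ) 1) : ‖semicirclePoint t‖ = 1 := by
  rw [← sq_eq_sq₀ (norm_nonneg _) zero_le_one, Complex.sq_norm, semicirclePoint, Complex.normSq_mk]
  linarith [semicirclePoint_re_sq ht]

lemma semicirclePoint_sq_re {t : ℝ} (ht : t ∈ Set.Icc (-1 : ℝ) 1) :
    (semicirclePoint t ^ 2).re = 1 - 2 * t ^ 2 := by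
  rw [sq, Complex.mul_re, semicirclePoint]
  linarith [semicirclePoint_re_sq ht]

lemma exists_semicirclePoint_sq_mul (ζ : ℂ) :
    ∃ t ∈ Set.Icc (-1 : ℝ) 1, semicirclePoint t ^ 2 * ‖ζ‖ = ζ := by
  refine ⟨Real.sin (ζ.arg / 2), ⟨Real.neg_one_le_sin _, Real.sin_le_one _⟩, ?_⟩
  have hc : 0 ≤ Real.cos (ζ.arg / 2) :=
    Real.cos_nonneg_of_mem_Icc ⟨by linarith [Complex.neg_pi_lt_arg ζ],
      by linarith [Complex.arg_le_pi ζ]⟩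
  have e : semicirclePoint (Real.sin (ζ.arg / 2)) = Complex.exp ((ζ.arg / 2 : ℝ) * Complex.I) := by
    rw [semicirclePoint, ← Real.abs_cos_eq_sqrt_one_sub_sin_sq, abs_of_nonneg hc]
    apply Complex.ext
    · rw [Complex.exp_ofReal_mul_I_re]
    · rw [Complex.exp_ofReal_mul_I_im]
  rw [e, ← Complex.exp_nat_mul, mul_comm]
  nth_rewrite 3 [← Complex.norm_mul_exp_arg_mul_I ζ]
  congr 2
  push_cast
  ring

/-- Parameters for the matrices `C` with singular values `c` whose sum with the diagonal matrix
of `b` has a prescribed Frobenius norm. -/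
def levelSet (b c : ℝ × ℝ) (n : ℝ) : Set (ℝ × ℂ × ℂ) :=
  {q | q.1 ∈ Set.Icc (-1 : ℝ) 1 ∧ q.2 ∈ diagonalRange c ∧
    (semicirclePoint q.1 * (b.1 * q.2.1 + b.2 * q.2.2)).re = n}

/-- The determinant of the sum of the matrix with parameters `q` and the diagonal matrix
of `b`. -/
noncomputable def sumDet (b c : ℝ × ℝ) (q : ℝ × ℂ × ℂ) : ℂ :=
  b.1 * b.2 + semicirclePoint q.1 * (b.1 * q.2.2 + b.2 * q.2.1) +
    semicirclePoint q.1 ^ 2 * (c.1 * c.2)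

lemma continuous_sumDet (b c : ℝ × ℝ) : Continuous (sumDet b c) := by
  have := continuous_semicirclePoint
  unfold sumDet
  fun_prop

lemma exists_offDiagonal {c : ℝ × ℝ} {p : ℂ × ℂ} (hp : p ∈ diagonalRange c) :
    ∃ z w : ℂ, p.1 * p.2 - z * w = (c.1 * c.2 : ℝ) ∧
      ‖p.1‖ ^ 2 + ‖z‖ ^ 2 + ‖w‖ ^ 2 + ‖p.2‖ ^ 2 = c.1 ^ 2 + c.2 ^ 2 := by
  simp only [diagonalRange, Set.mem_ofPred_eq] at hp
  obtain ⟨z, w, h, h'⟩ := exists_mul_eq_and_sq_add_sq_eq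
    (ζ := p.1 * p.2 - (c.1 * c.2 : ℝ)) (r := c.1 ^ 2 + c.2 ^ 2 - ‖p.1‖ ^ 2 - ‖p.2‖ ^ 2)
    (by linarith)
  exact ⟨z, w, by rw [h]; ring, by linarith⟩

lemma trace_re_sq_le (α β γ δ : ℂ) :
    (α + δ).re ^ 2 ≤ ‖α‖ ^ 2 + ‖β‖ ^ 2 + ‖γ‖ ^ 2 + ‖δ‖ ^ 2 + 2 * (α * δ - β * γ).re := by
  simp only [Complex.sq_norm, Complex.normSq_apply, Complex.sub_re, Complex.mul_re, Complex.add_re]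
  nlinarith [sq_nonneg (α.im - δ.im), sq_nonneg (β.re - γ.re), sq_nonneg (β.im + γ.im)]

lemma row_norm_sq_le {c : ℝ × ℝ} (hc : IsSortedPair c) {x y z w : ℂ}
    (hd : x * y - z * w = (c.1 * c.2 : ℝ))
    (hf : ‖x‖ ^ 2 + ‖z‖ ^ 2 + ‖w‖ ^ 2 + ‖y‖ ^ 2 = c.1 ^ 2 + c.2 ^ 2) :
    ‖x‖ ^ 2 + ‖z‖ ^ 2 ≤ c.1 ^ 2 := by
  have h₁ : c.1 * c.2 ≤ ‖x‖ * ‖y‖ + ‖z‖ * ‖w‖ := by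
    rw [← norm_mul, ← norm_mul, ← Real.norm_of_nonneg hc.mul_nonneg, ← Complex.norm_real, ← hd]
    exact norm_sub_le _ _
  have h₂ : (c.1 * c.2) ^ 2 ≤ (‖x‖ ^ 2 + ‖z‖ ^ 2) * (‖w‖ ^ 2 + ‖y‖ ^ 2) := by
    have := pow_le_pow_left₀ hc.mul_nonneg h₁ 2
    nlinarith [sq_nonneg (‖x‖ * ‖w‖ - ‖y‖ * ‖z‖)]
  have h₃ : c.2 ^ 2 ≤ c.1 ^ 2 := pow_le_pow_left₀ hc.1 hc.2 2
  by_contra! h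
  nlinarith

/-- The maximum of the linear form cutting out `levelSet` at parameter `t` is `‖maxForm b c t‖`. -/
noncomputable def maxForm (b c : ℝ × ℝ) (t : ℝ) : ℂ :=
  semicirclePoint t * (b.1 * c.1 : ℝ) + star (semicirclePoint t) * (b.2 * c.2 : ℝ)

lemma norm_maxForm_sq {b c : ℝ × ℝ} {t : ℝ} (ht : t ∈ Set.Icc (-1 : ℝ) 1) :
    ‖maxForm b c t‖ ^ 2 = (b.1 * c.1) ^ 2 + (b.2 * c.2) ^ 2 +
      2 * (b.1 * b.2 * (c.1 * c.2)) * (1 - 2 * t ^ 2) := by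
  have h := semicirclePoint_re_sq ht
  rw [Complex.sq_norm, Complex.normSq_apply]
  simp [maxForm, semicirclePoint]
  linear_combination (b.1 * c.1 + b.2 * c.2) ^ 2 * h

lemma sq_le_norm_maxForm_sq {b c : ℝ × ℝ} (hb : IsSortedPair b) (hc : IsSortedPair c) {n : ℝ}
    {q : ℝ × ℂ × ℂ} (hq : q ∈ levelSet b c n) : n ^ 2 ≤ ‖maxForm b c q.1‖ ^ 2 := by
  obtain ⟨ht, hp, hn⟩ := hq
  obtain ⟨z, w, hd, hf⟩ := exists_offDiagonal hp
  have hrow := row_norm_sq_le hc hd hf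
  set κ := semicirclePoint q.1
  have hκ : ‖κ‖ = 1 := norm_semicirclePoint ht
  have hb' : b.2 ^ 2 ≤ b.1 ^ 2 := pow_le_pow_left₀ hb.1 hb.2 2
  have h := trace_re_sq_le (κ * (b.1 * q.2.1)) (κ * (b.1 * z)) (κ * (b.2 * w))
    (κ * (b.2 * q.2.2))
  rw [← mul_add, hn] at h
  have e : κ * (b.1 * q.2.1) * (κ * (b.2 * q.2.2)) - κ * (b.1 * z) * (κ * (b.2 * w)) =
      ((b.1 * b.2 * (c.1 * c.2) : ℝ) : ℂ) * κ ^ 2 := by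
    push_cast at hd ⊢
    linear_combination κ ^ 2 * b.1 * b.2 * hd
  rw [e, Complex.re_ofReal_mul, semicirclePoint_sq_re ht] at h
  simp only [norm_mul, hκ, one_mul, Complex.norm_real, Real.norm_eq_abs, mul_pow, sq_abs] at h
  rw [norm_maxForm_sq ht]
  nlinarith [mul_nonneg (sub_nonneg.2 hb') (sub_nonneg.2 hrow)]

/-- A continuous choice of a point of `levelSet` over every admissible parameter `t`. -/
noncomputable def levelSection (b c : ℝ × ℝ) (n t : ℝ) : ℝ × ℂ × ℂ :=
  (t, n * c.1 / maxForm b c t, n * c.2 / star (maxForm b c t))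

lemma levelSection_mem {b c : ℝ × ℝ} (hc : IsSortedPair c) {n t : ℝ}
    (ht : t ∈ Set.Icc (-1 : ℝ) 1) (hn : n ^ 2 ≤ ‖maxForm b c t‖ ^ 2) :
    levelSection b c n t ∈ levelSet b c n := by
  have hd := hc.mul_nonneg
  rcases eq_or_ne (maxForm b c t) 0 with h0 | h0
  · have : n = 0 := by
      rw [h0, norm_zero] at hn
      nlinarith
    subst this
    refine ⟨ht, ?_, by simp [levelSection]⟩
    simp [levelSection, diagonalRange]
    rw [← abs_mul, abs_of_nonneg hd]
    nlinarith [sq_nonneg (c.1 - c.2)]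
  have hpos : 0 < ‖maxForm b c t‖ ^ 2 := by positivity
  refine ⟨ht, ?_, ?_⟩
  · set r := n ^ 2 / ‖maxForm b c t‖ ^ 2 with hr
    have hr1 : r ≤ 1 := div_le_one_of_le₀ hn hpos.le
    have e₁ : (n * c.1 / maxForm b c t) * (n * c.2 / star (maxForm b c t)) =
        ((r * (c.1 * c.2) : ℝ) : ℂ) := by
      rw [div_mul_div_comm, Complex.star_def, Complex.mul_conj']
      push_cast [hr]
      ring
    have e₂ : ‖(n * c.1 / maxForm b c t : ℂ)‖ ^ 2 = r * c.1 ^ 2 := by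
      rw [norm_div, norm_mul, div_pow, mul_pow, Complex.norm_real, Complex.norm_real,
        Real.norm_eq_abs, Real.norm_eq_abs, sq_abs, sq_abs]
      ring
    have e₃ : ‖(n * c.2 / star (maxForm b c t) : ℂ)‖ ^ 2 = r * c.2 ^ 2 := by
      rw [norm_div, norm_mul, div_pow, mul_pow, Complex.norm_real, Complex.norm_real,
        Real.norm_eq_abs, Real.norm_eq_abs, sq_abs, sq_abs, norm_star]
      ring
    simp only [levelSection, diagonalRange, Set.mem_ofPred_eq]
    rw [e₁, e₂, e₃, ← Complex.ofReal_sub, Complex.norm_real, Real.norm_eq_abs,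
      abs_of_nonpos (by nlinarith)]
    nlinarith [mul_nonneg (sub_nonneg.2 hr1) (sq_nonneg (c.1 - c.2))]
  · set κ := semicirclePoint t with hκ
    have e : (κ * (b.1 * (n * c.1 / maxForm b c t) +
        b.2 * (n * c.2 / star (maxForm b c t)))).re = (n * maxForm b c t / maxForm b c t).re := by
      have : (κ * (b.2 * (n * c.2 / star (maxForm b c t)))).re =
          (star κ * (b.2 * (n * c.2 / maxForm b c t))).re := by
        rw [← Complex.conj_re]
        simp
      rw [mul_add, Complex.add_re, this, ← Complex.add_re]
      congr 1
      nth_rewrite 3 [maxForm]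
      push_cast
      ring
    exact e.trans (by rw [mul_div_cancel_right₀ _ h0, Complex.ofReal_re])

lemma isPreconnected_levelSet {b c : ℝ × ℝ} (hb : IsSortedPair b) (hc : IsSortedPair c) (n : ℝ) :
    IsPreconnected (levelSet b c n) := by
  set R : Set ℝ := {t | t ∈ Set.Icc (-1 : ℝ) 1 ∧ n ^ 2 ≤ ‖maxForm b c t‖ ^ 2} with hR
  have hRconn : IsPreconnected R := by
    refine Set.OrdConnected.isPreconnected ⟨?_⟩
    rintro s ⟨hs, hs'⟩ t ⟨ht, ht'⟩ u ⟨hsu, hut⟩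
    have hu : u ∈ Set.Icc (-1 : ℝ) 1 := ⟨hs.1.trans hsu, hut.trans ht.2⟩
    refine ⟨hu, ?_⟩
    rw [norm_maxForm_sq hs] at hs'
    rw [norm_maxForm_sq ht] at ht'
    rw [norm_maxForm_sq hu]
    have hp := mul_nonneg hb.mul_nonneg hc.mul_nonneg
    rcases le_total 0 u with h | h
    · nlinarith [mul_nonneg hp (mul_nonneg (sub_nonneg.2 hut) (add_nonneg h (h.trans hut)))]
    · nlinarith [mul_nonneg hp (mul_nonneg (sub_nonneg.2 hsu)
        (add_nonneg (neg_nonneg.2 h) (neg_nonneg.2 (hsu.trans h))))]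
  have hcont : ContinuousOn (levelSection b c n) R := by
    rcases eq_or_ne n 0 with rfl | hn
    · unfold levelSection
      simp only [Complex.ofReal_zero, zero_mul, zero_div]
      fun_prop
    have hne : ∀ t ∈ R, maxForm b c t ≠ 0 := by
      rintro t ⟨-, ht⟩ h
      rw [h, norm_zero] at ht
      have := pow_pos (abs_pos.2 hn) 2
      rw [sq_abs] at this
      linarith
    have hm : Continuous (maxForm b c) := by
      have := continuous_semicirclePoint
      unfold maxForm
      fun_prop
    refine continuousOn_id.prodMk (.prodMk ?_ ?_)
    · exact continuousOn_const.div hm.continuousOn hne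
    · exact continuousOn_const.div hm.star.continuousOn fun t ht => star_ne_zero.2 (hne t ht)
  have hsub : levelSection b c n '' R ⊆ levelSet b c n := by
    rintro _ ⟨t, ht, rfl⟩
    exact levelSection_mem hc ht.1 ht.2
  rcases (levelSet b c n).eq_empty_or_nonempty with h | ⟨q₀, hq₀⟩
  · rw [h]
    exact isPreconnected_empty
  refine isPreconnected_of_forall (levelSection b c n q₀.1) fun q hq => ?_
  have hqR : q.1 ∈ R := ⟨hq.1, sq_le_norm_maxForm_sq hb hc hq⟩
  set S : Set (ℂ × ℂ) := {p | (q.1, p) ∈ levelSet b c n} with hS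
  have hSconv : Convex ℝ S := by
    intro p hp p' hp' s t hs ht hst
    refine ⟨hq.1, convex_diagonalRange c hp.2.1 hp'.2.1 hs ht hst, ?_⟩
    have h₁ := hp.2.2
    have h₂ := hp'.2.2
    have e : semicirclePoint q.1 * (b.1 * (s • p + t • p').1 + b.2 * (s • p + t • p').2) =
        s * (semicirclePoint q.1 * (b.1 * p.1 + b.2 * p.2)) +
        t * (semicirclePoint q.1 * (b.1 * p'.1 + b.2 * p'.2)) := by
      simp
      ring
    simp only
    rw [e, Complex.add_re, Complex.re_ofReal_mul, Complex.re_ofReal_mul, h₁, h₂, ← add_mul, hst,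
      one_mul]
  refine ⟨(fun p => (q.1, p)) '' S ∪ levelSection b c n '' R, ?_, .inr ⟨_, ⟨hq₀.1,
    sq_le_norm_maxForm_sq hb hc hq₀⟩, rfl⟩, .inl ⟨q.2, hq, rfl⟩, ?_⟩
  · refine Set.union_subset ?_ hsub
    rintro _ ⟨p, hp, rfl⟩
    exact hp
  · refine IsPreconnected.union (levelSection b c n q.1)
      ⟨_, levelSection_mem hc hqR.1 hqR.2, rfl⟩ ⟨_, hqR, rfl⟩ ?_ (hRconn.image _ hcont)
    exact hSconv.isPreconnected.image _ (by fun_prop)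

noncomputable def frobeniusLevel (a b c : ℝ × ℝ) : ℝ :=
  (a.1 ^ 2 + a.2 ^ 2 - (b.1 ^ 2 + b.2 ^ 2) - (c.1 ^ 2 + c.2 ^ 2)) / 2

lemma realizable_of_mem_levelSet {a b c : ℝ × ℝ} (hb : IsSortedPair b) (hc : IsSortedPair c)
    {q : ℝ × ℂ × ℂ} (hq : q ∈ levelSet b c (frobeniusLevel a b c))
    (hd : ‖sumDet b c q‖ = a.1 * a.2) : Realizable a b c := by
  obtain ⟨ht, hp, hn⟩ := hq
  obtain ⟨z, w, hzw, hf⟩ := exists_offDiagonal hp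
  set κ := semicirclePoint q.1 with hκdef
  have hκ : ‖κ‖ = 1 := norm_semicirclePoint ht
  set B : Matrix (Fin 2) (Fin 2) ℂ := !![(b.1 : ℂ), 0; 0, (b.2 : ℂ)] with hB
  set C : Matrix (Fin 2) (Fin 2) ℂ := !![κ * q.2.1, κ * z; κ * w, κ * q.2.2] with hC
  refine ⟨-(B + C), B, C, by abel, ⟨?_, ?_⟩, hasSingularPair_diag (.inl ?_), ?_, ?_⟩
  · have e : ∀ (r : ℝ) (u : ℂ), ‖(r : ℂ) + κ * u‖ ^ 2 = r ^ 2 + ‖u‖ ^ 2 + 2 * (κ * (r * u)).re := by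
      intro r u
      have h : ‖κ * u‖ = ‖u‖ := by rw [norm_mul, hκ, one_mul]
      rw [← h, Complex.sq_norm, Complex.sq_norm, Complex.normSq_add, Complex.normSq_ofReal,
        ← Complex.conj_re]
      simp
      ring
    rw [mul_add, Complex.add_re, frobeniusLevel] at hn
    simp only [hB, hC, Matrix.neg_apply, Matrix.add_apply, Matrix.of_apply, Matrix.cons_val',
      Matrix.cons_val_zero, Matrix.cons_val_one, Matrix.cons_val_fin_one, norm_neg, e, zero_add,
      norm_mul, hκ, one_mul]
    linarith
  · rw [← hd, sumDet, Matrix.det_neg, Fintype.card_fin, neg_one_sq, one_mul]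
    congr 1
    push_cast at hzw
    rw [Matrix.det_fin_two, ← hκdef]
    simp [hB, hC]
    linear_combination κ ^ 2 * hzw
  · simp [abs_of_nonneg hb.1, abs_of_nonneg (hb.1.trans hb.2)]
  · simp only [hC, Matrix.of_apply, Matrix.cons_val', Matrix.cons_val_zero, Matrix.cons_val_one,
      Matrix.cons_val_fin_one, norm_mul, hκ, one_mul]
    exact hf
  · have : C.det = κ ^ 2 * (c.1 * c.2 : ℝ) := by
      rw [hC, Matrix.det_fin_two_of, ← hzw]
      ring
    rw [this, norm_mul, norm_pow, hκ, one_pow, one_mul, Complex.norm_real,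
      Real.norm_of_nonneg hc.mul_nonneg]

lemma Realizable.exists_mem_levelSet {a b c : ℝ × ℝ} (hb : IsSortedPair b)
    (h : Realizable a b c) :
    ∃ q ∈ levelSet b c (frobeniusLevel a b c), ‖sumDet b c q‖ = a.1 * a.2 := by
  obtain ⟨A, B, C, hsum, hA, hB, hC⟩ := h
  obtain ⟨U, hU, V, hV, hBD⟩ := hB.exists_unitary hb
  replace hA := hA.unitary_mul_mul hU hV
  replace hC := hC.unitary_mul_mul hU hV
  set C' := star U * C * V
  have hA' : star U * A * V = -(!![(b.1 : ℂ), 0; 0, (b.2 : ℂ)] + C') := by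
    have : A = -(B + C) := by rw [eq_neg_iff_add_eq_zero, ← hsum]; abel
    rw [this, ← hBD, ← Matrix.add_mul, ← Matrix.mul_add, Matrix.mul_neg, Matrix.neg_mul]
  rw [hA'] at hA
  obtain ⟨hA₁, hA₂⟩ := hA
  obtain ⟨hC₁, hC₂⟩ := hC
  obtain ⟨t, ht, hκ⟩ := exists_semicirclePoint_sq_mul C'.det
  have hκ1 := norm_semicirclePoint ht
  set κ := semicirclePoint t with hκdef
  have hκκ : κ * star κ = 1 := by
    rw [Complex.star_def, Complex.mul_conj', hκ1]
    simp
  rw [hC₂] at hκ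
  rw [Matrix.det_fin_two] at hκ
  refine ⟨(t, star κ * C' 0 0, star κ * C' 1 1), ⟨ht, ?_, ?_⟩, ?_⟩
  · have e : star κ * C' 0 0 * (star κ * C' 1 1) - (c.1 * c.2 : ℝ) =
        star κ ^ 2 * (C' 0 1 * C' 1 0) := by
      linear_combination (-star κ ^ 2) * hκ +
        (κ * star κ + 1) * (c.1 * c.2 : ℝ) * hκκ
    simp only [diagonalRange, Set.mem_ofPred_eq]
    rw [e]
    simp only [norm_mul, norm_pow, norm_star, hκ1, one_pow, one_mul]
    nlinarith [sq_nonneg (‖C' 0 1‖ - ‖C' 1 0‖)]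
  · have e : ∀ (r : ℝ) (u : ℂ), ‖(r : ℂ) + u‖ ^ 2 = r ^ 2 + ‖u‖ ^ 2 + 2 * (r * u).re := by
      intro r u
      rw [Complex.sq_norm, Complex.sq_norm, Complex.normSq_add, Complex.normSq_ofReal]
      simp
      ring
    have e' : κ * (b.1 * (star κ * C' 0 0) + b.2 * (star κ * C' 1 1)) =
        b.1 * C' 0 0 + b.2 * C' 1 1 := by
      linear_combination (b.1 * C' 0 0 + b.2 * C' 1 1) * hκκ
    simp only [Matrix.neg_apply, Matrix.add_apply, Matrix.of_apply, Matrix.cons_val',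
      Matrix.cons_val_zero, Matrix.cons_val_one, Matrix.cons_val_fin_one, norm_neg, e,
      zero_add] at hA₁
    simp only [← hκdef]
    rw [e', Complex.add_re, frobeniusLevel]
    linarith
  · rw [← hA₂, sumDet, Matrix.det_neg, Fintype.card_fin, neg_one_sq, one_mul]
    congr 1
    rw [Matrix.det_fin_two]
    push_cast at hκ
    simp [← hκdef]
    simp only [Complex.star_def] at hκκ
    linear_combination hκ + (b.1 * C' 1 1 + b.2 * C' 0 0) * hκκ

/-- For a fixed Frobenius norm of the first summand, the realizable determinants form an
interval. -/
lemma Realizable.of_between {a a' a'' b c : ℝ × ℝ} (hb : IsSortedPair b) (hc : IsSortedPair c)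
    (h' : Realizable a' b c) (h'' : Realizable a'' b c)
    (e' : a'.1 ^ 2 + a'.2 ^ 2 = a.1 ^ 2 + a.2 ^ 2)
    (e'' : a''.1 ^ 2 + a''.2 ^ 2 = a.1 ^ 2 + a.2 ^ 2)
    (hle : a'.1 * a'.2 ≤ a.1 * a.2) (hle' : a.1 * a.2 ≤ a''.1 * a''.2) : Realizable a b c := by
  obtain ⟨q', hq', hd'⟩ := h'.exists_mem_levelSet hb
  obtain ⟨q'', hq'', hd''⟩ := h''.exists_mem_levelSet hb
  rw [frobeniusLevel, e', ← frobeniusLevel] at hq'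
  rw [frobeniusLevel, e'', ← frobeniusLevel] at hq''
  obtain ⟨q, hq, hd⟩ := (isPreconnected_levelSet hb hc _).intermediate_value hq' hq''
    (continuous_sumDet b c).norm.continuousOn (show a.1 * a.2 ∈ Set.Icc _ _ by
      rw [hd', hd'']; exact ⟨hle, hle'⟩)
  exact realizable_of_mem_levelSet hb hc hq hd

/-- The nonnegative pair with second entry `s` and sum of squares `N`. -/
noncomputable def circlePair (N s : ℝ) : ℝ × ℝ := (√(N - s ^ 2), s)

lemma circlePair_sq {N s : ℝ} (h : s ^ 2 ≤ N) :
    (circlePair N s).1 ^ 2 + (circlePair N s).2 ^ 2 = N := by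
  rw [circlePair, Real.sq_sqrt (sub_nonneg.2 h)]
  ring

lemma isSortedPair_circlePair {N s : ℝ} (hs : 0 ≤ s) (h : 2 * s ^ 2 ≤ N) :
    IsSortedPair (circlePair N s) :=
  ⟨hs, Real.le_sqrt_of_sq_le (show s ^ 2 ≤ N - s ^ 2 by linarith)⟩

lemma circlePair_eq {a : ℝ × ℝ} (ha : IsSortedPair a) :
    circlePair (a.1 ^ 2 + a.2 ^ 2) a.2 = a := by
  rw [circlePair, add_sub_cancel_right, Real.sqrt_sq (ha.1.trans ha.2)]

lemma exists_realizable_circlePair {b c : ℝ × ℝ} (hb : IsSortedPair b) (hc : IsSortedPair c)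
    {N s e : ℝ} (hs : 0 ≤ s) (hs' : 2 * s ^ 2 ≤ N) (he : 0 ≤ e) (he' : 2 * e ^ 2 ≤ N)
    (h : 0 ≤ totalSlack (circlePair N s) b c)
    (hend : 0 ≤ totalSlack (circlePair N e) b c → Realizable (circlePair N e) b c) :
    ∃ u ∈ Set.uIcc e s, Realizable (circlePair N u) b c := by
  by_cases h0 : 0 ≤ totalSlack (circlePair N e) b c
  · exact ⟨e, Set.left_mem_uIcc, hend h0⟩
  have hcont : Continuous fun u => totalSlack (circlePair N u) b c := by
    have : Continuous (circlePair N) := by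
      unfold circlePair
      fun_prop
    exact (continuous_totalSlack b c).comp this
  obtain ⟨u, hu, hu0⟩ := intermediate_value_uIcc (a := e) (b := s) hcont.continuousOn
    (Set.Icc_subset_uIcc ⟨(not_le.1 h0).le, h⟩)
  refine ⟨u, hu, realizable_of_totalSlack_eq_zero (isSortedPair_circlePair ?_ ?_) hb hc hu0⟩
  · rcases Set.mem_uIcc.1 hu with hu | hu <;> linarith
  · rcases Set.mem_uIcc.1 hu with hu | hu <;> nlinarith

lemma circlePair_mul_le {N s t : ℝ} (hs : 0 ≤ s) (hst : s ≤ t) (ht : 2 * t ^ 2 ≤ N) :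
    (circlePair N s).1 * (circlePair N s).2 ≤ (circlePair N t).1 * (circlePair N t).2 := by
  have hst2 := pow_le_pow_left₀ hs hst 2
  have h₁ := Real.sq_sqrt (show 0 ≤ N - s ^ 2 by nlinarith)
  have h₂ := Real.sq_sqrt (show 0 ≤ N - t ^ 2 by nlinarith)
  refine (sq_le_sq₀ (mul_nonneg (Real.sqrt_nonneg _) hs)
    (mul_nonneg (Real.sqrt_nonneg _) (hs.trans hst))).1 ?_
  rw [mul_pow, mul_pow, h₁, h₂]
  nlinarith [mul_nonneg (sub_nonneg.2 hst2) (show 0 ≤ N - s ^ 2 - t ^ 2 by linarith)]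

/-- Realizability follows from the Lidskii inequalities once it is known at two pairs on either
side of `a` with the same sum of squares. -/
lemma realizable_of_endpoints {a b c : ℝ × ℝ} (ha : IsSortedPair a) (hb : IsSortedPair b)
    (hc : IsSortedPair c) (h : 0 ≤ totalSlack a b c) {l r : ℝ} (hl : 0 ≤ l) (hla : l ≤ a.2)
    (har : a.2 ≤ r) (hr : 2 * r ^ 2 ≤ a.1 ^ 2 + a.2 ^ 2)
    (hL : ∀ x : ℝ × ℝ, IsSortedPair x → x.1 ^ 2 + x.2 ^ 2 = a.1 ^ 2 + a.2 ^ 2 → x.2 = l →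
      0 ≤ totalSlack x b c → Realizable x b c)
    (hR : ∀ x : ℝ × ℝ, IsSortedPair x → x.1 ^ 2 + x.2 ^ 2 = a.1 ^ 2 + a.2 ^ 2 → x.2 = r →
      0 ≤ totalSlack x b c → Realizable x b c) : Realizable a b c := by
  set N := a.1 ^ 2 + a.2 ^ 2 with hN
  have hae := circlePair_eq ha
  rw [← hN] at hae
  have ha2 := ha.1
  have ha' : 2 * a.2 ^ 2 ≤ N := by nlinarith [ha.2]
  have hl' : 2 * l ^ 2 ≤ N := by nlinarith
  have hsq : ∀ u, 2 * u ^ 2 ≤ N → u ^ 2 ≤ N := fun u hu => by nlinarith [sq_nonneg u]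
  have hr0 := ha2.trans har
  rw [← hae] at h
  obtain ⟨u, hu, hur⟩ := exists_realizable_circlePair hb hc ha2 ha' hl hl' h
    (hL _ (isSortedPair_circlePair hl hl') (circlePair_sq (hsq _ hl')) rfl)
  obtain ⟨v, hv, hvr⟩ := exists_realizable_circlePair hb hc ha2 ha' hr0 hr h
    (hR _ (isSortedPair_circlePair hr0 hr) (circlePair_sq (hsq _ hr)) rfl)
  rw [Set.uIcc_of_le hla] at hu
  rw [Set.uIcc_of_ge har] at hv
  have hu' : 2 * u ^ 2 ≤ N := by nlinarith [hu.1, hu.2]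
  have hv' : 2 * v ^ 2 ≤ N := by nlinarith [hv.1, hv.2]
  refine hur.of_between hb hc hvr (circlePair_sq (hsq _ hu')) (circlePair_sq (hsq _ hv')) ?_ ?_
  · conv_rhs => rw [← hae]
    exact circlePair_mul_le (hl.trans hu.1) hu.2 ha'
  · conv_lhs => rw [← hae]
    exact circlePair_mul_le ha2 hv.1 hv'

lemma realizable_of_scalar_of_rank_one {a b c : ℝ × ℝ} (ha : IsSortedPair a)
    (hb : IsSortedPair b) (hc : IsSortedPair c) (ha' : a.1 = a.2) (hb' : b.2 = 0)
    (hac : c.2 < a.2) (h : 0 ≤ totalSlack a b c) : Realizable a b c := by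
  simp only [totalSlack, le_min_iff, lidskiiSlack_nonneg_iff] at h
  obtain ⟨⟨⟨_, _⟩, ⟨_, _⟩, _, _, _, _⟩, ⟨⟨_, _⟩, ⟨_, _⟩, _, _, _, _⟩,
    ⟨⟨_, _⟩, ⟨_, _⟩, _, _, _, _⟩⟩ := h
  obtain ⟨x, a₂⟩ := a
  obtain ⟨b₁, b₂⟩ := b
  obtain ⟨c₁, c₂⟩ := c
  obtain ⟨_, _⟩ := ha
  obtain ⟨_, _⟩ := hb
  obtain ⟨_, _⟩ := hc
  dsimp only at *
  subst ha' hb'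
  have hx : 0 < x := by linarith
  have hxc : 0 ≤ (c₁ ^ 2 - x ^ 2) * (x ^ 2 - c₂ ^ 2) := by
    apply mul_nonneg <;> nlinarith
  set y := c₁ * c₂ / x with hy
  have hyx : x * y = c₁ * c₂ := by rw [hy]; field_simp
  have hy0 : 0 ≤ y := div_nonneg (mul_nonneg (by linarith) ‹_›) hx.le
  set z := √(c₁ ^ 2 + c₂ ^ 2 - x ^ 2 - y ^ 2) with hz
  have hz2 : z ^ 2 = c₁ ^ 2 + c₂ ^ 2 - x ^ 2 - y ^ 2 := by
    refine Real.sq_sqrt (nonneg_of_mul_nonneg_right (a := x ^ 2) ?_ (by positivity))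
    have : (x * y) ^ 2 = (c₁ * c₂) ^ 2 := by rw [hyx]
    nlinarith
  have hm1 : (c₁ - c₂) ^ 2 ≤ b₁ ^ 2 := pow_le_pow_left₀ (by linarith) (by linarith) 2
  have hm2 : b₁ ^ 2 ≤ (c₁ + c₂) ^ 2 := pow_le_pow_left₀ (by linarith) (by linarith) 2
  have hbz : (x - y) ^ 2 ≤ b₁ ^ 2 - z ^ 2 := by nlinarith
  have hbz' : b₁ ^ 2 - z ^ 2 ≤ (x + y) ^ 2 := by nlinarith
  have hm := Real.sq_sqrt ((sq_nonneg _).trans hbz)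
  have hm0 := Real.sqrt_nonneg (b₁ ^ 2 - z ^ 2)
  set m := √(b₁ ^ 2 - z ^ 2)
  rw [← hm] at hbz hbz'
  have hd := abs_le_of_sq_le_sq' hbz hm0
  have hs := abs_le_of_sq_le_sq hbz' (by linarith)
  rw [abs_of_nonneg hm0] at hs
  obtain ⟨u, v, w, huvw, hu, hv, hw⟩ := IsTriangle.exists_complex (x := x) (y := m) (z := y)
    ⟨by linarith [hd.2], by linarith, by linarith [hd.1]⟩
  refine ⟨!![u, 0; 0, u], !![0, -(z : ℂ); 0, v], !![-u, (z : ℂ); 0, w], ?_,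
    hasSingularPair_diag (.inl ⟨hu, hu⟩), ⟨?_, ?_⟩, ?_, ?_⟩
  · ext i j
    fin_cases i <;> fin_cases j <;> simp [huvw]
  · simp [hv, hm]
  · simp [Matrix.det_fin_two]
  · simp [hu, hw]
    linarith
  · simp [Matrix.det_fin_two, hu, hw, hyx]

lemma isTriangle_fst {a b c : ℝ × ℝ} (h : 0 ≤ totalSlack a b c) : IsTriangle a.1 b.1 c.1 := by
  simp only [totalSlack, le_min_iff, lidskiiSlack_nonneg_iff] at h
  obtain ⟨⟨⟨_, _⟩, -⟩, ⟨⟨_, _⟩, -⟩, -⟩ := h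
  refine ⟨?_, ?_, ?_⟩ <;> linarith

lemma snd_le_of_totalSlack_nonneg {a b c : ℝ × ℝ} (h : 0 ≤ totalSlack a b c) :
    a.2 ≤ b.1 + c.2 := by
  simp only [totalSlack, le_min_iff, lidskiiSlack_nonneg_iff] at h
  obtain ⟨-, -, -, ⟨_, _⟩, -⟩ := h
  linarith

lemma sq_add_sq_half_bound {a : ℝ × ℝ} (ha : IsSortedPair a) :
    a.2 ≤ √((a.1 ^ 2 + a.2 ^ 2) / 2) := by
  refine Real.le_sqrt_of_sq_le ?_
  nlinarith [ha.1, ha.2]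

lemma IsSortedPair.fst_eq_snd {x : ℝ × ℝ} {N : ℝ} (hx : IsSortedPair x)
    (hN : x.1 ^ 2 + x.2 ^ 2 = N) (h : x.2 = √(N / 2)) : x.1 = x.2 := by
  have h₁ : x.2 ^ 2 = N / 2 := by
    rw [h, Real.sq_sqrt]
    rw [← hN]
    positivity
  exact (sq_eq_sq₀ (hx.1.trans hx.2) hx.1).1 (by linarith)

lemma realizable_of_scalar {a b c : ℝ × ℝ} (ha : IsSortedPair a) (hb : IsSortedPair b)
    (hc : IsSortedPair c) (ha' : a.1 = a.2) (habc : b.2 + c.2 < a.2)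
    (h : 0 ≤ totalSlack a b c) : Realizable a b c := by
  have hN : 0 ≤ (b.1 ^ 2 + b.2 ^ 2) / 2 := by positivity
  have hb0 := hb.1
  have hc0 := hc.1
  have hr : b.2 ≤ min (a.2 - c.2) √((b.1 ^ 2 + b.2 ^ 2) / 2) :=
    le_min (by linarith) (sq_add_sq_half_bound hb)
  refine (realizable_of_endpoints (l := 0) hb ha hc (by rwa [totalSlack_swap]) le_rfl hb0 hr
    ?_ ?_ ?_).swap
  · have := (sq_le_sq₀ (hb0.trans hr) (Real.sqrt_nonneg _)).2 (min_le_right _ _)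
    rw [Real.sq_sqrt hN] at this
    linarith
  · intro x hx _ hx0 hs
    rw [totalSlack_swap] at hs
    exact (realizable_of_scalar_of_rank_one ha hx hc ha' hx0 (by linarith) hs).swap
  · intro x hx hxN hxr hs
    rw [totalSlack_swap] at hs
    refine (realizable_of_isTriangle (isTriangle_fst hs) ?_).swap
    have h₁ := hxr.trans_le (min_le_left _ _)
    have h₂ : a.2 ≤ x.2 + c.2 := by
      rcases min_choice (a.2 - c.2) √((b.1 ^ 2 + b.2 ^ 2) / 2) with e | e <;> rw [e] at hxr
      · linarith
      · rw [← hx.fst_eq_snd hxN hxr]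
        exact snd_le_of_totalSlack_nonneg hs
    exact ⟨h₂, by linarith, by linarith [hx.1]⟩

lemma realizable_of_add_lt {a b c : ℝ × ℝ} (ha : IsSortedPair a) (hb : IsSortedPair b)
    (hc : IsSortedPair c) (habc : b.2 + c.2 < a.2) (h : 0 ≤ totalSlack a b c) :
    Realizable a b c := by
  have hN : 0 ≤ (a.1 ^ 2 + a.2 ^ 2) / 2 := by positivity
  have ha2 := sq_add_sq_half_bound ha
  have hb0 := hb.1
  have hc0 := hc.1
  refine realizable_of_endpoints (l := b.2 + c.2) ha hb hc h (by linarith) habc.le ha2 ?_ ?_ ?_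
  · rw [Real.sq_sqrt hN]
    linarith
  · intro x _ _ hx hs
    exact realizable_of_isTriangle (isTriangle_fst hs)
      ⟨by linarith, by linarith, by linarith⟩
  · intro x hx hxN hxr hs
    exact realizable_of_scalar hx hb hc (hx.fst_eq_snd hxN hxr) (by linarith) hs

/-- The Lidskii inequalities suffice for realizability. -/
theorem realizable_of_totalSlack_nonneg {a b c : ℝ × ℝ} (ha : IsSortedPair a)
    (hb : IsSortedPair b) (hc : IsSortedPair c) (h : 0 ≤ totalSlack a b c) :
    Realizable a b c := by
  rcases lt_or_ge (b.2 + c.2) a.2 with h₁ | h₁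
  · exact realizable_of_add_lt ha hb hc h₁ h
  rcases lt_or_ge (c.2 + a.2) b.2 with h₂ | h₂
  · exact (realizable_of_add_lt hb hc ha h₂ (by rwa [totalSlack_rotate])).rotate.rotate
  rcases lt_or_ge (a.2 + b.2) c.2 with h₃ | h₃
  · exact (realizable_of_add_lt hc ha hb h₃
      (by rwa [totalSlack_rotate, totalSlack_rotate] )).rotate
  · exact realizable_of_isTriangle (isTriangle_fst h) ⟨h₁, by linarith, h₃⟩

lemma singularValues_eq_of_hasSingularPair {M : Matrix (Fin 2) (Fin 2) ℂ} {p : ℕ}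
    {A : Matrix (Fin p) (Fin 2) ℂ} (h : HasSingularPair M (singularPair A)) :
    singularValues M = singularValues A := by
  have e := h.unique (isSortedPair_singularPair A) (isSortedPair_singularPair M)
    (hasSingularPair_singularPair M)
  ext i
  fin_cases i
  · exact congrArg Prod.fst e.symm
  · exact congrArg Prod.snd e.symm

lemma singularCone_subset {p : ℕ} (hp : 2 ≤ p) : SingularCone p 2 ⊆ SingularCone 2 2 := by
  rintro ⟨_, _, _⟩ ⟨A, B, C, h, rfl, rfl, rfl⟩
  obtain ⟨A', B', C', h', hA, hB, hC⟩ := realizable_of_totalSlack_nonneg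
    (isSortedPair_singularPair A) (isSortedPair_singularPair B) (isSortedPair_singularPair C)
    (totalSlack_nonneg_of_hasSVD (hasSVD_singularPair hp A) (hasSVD_singularPair hp B)
      (hasSVD_singularPair hp C) (isSortedPair_singularPair A) (isSortedPair_singularPair B)
      (isSortedPair_singularPair C) (by rw [← map_add, ← map_add, h, map_zero]))
  exact ⟨A', B', C', h', singularValues_eq_of_hasSingularPair hA,
    singularValues_eq_of_hasSingularPair hB, singularValues_eq_of_hasSingularPair hC⟩

lemma subset_singularCone {p : ℕ} (hp : 2 ≤ p) : SingularCone 2 2 ⊆ SingularCone p 2 := by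
  rintro ⟨_, _, _⟩ ⟨A, B, C, h, rfl, rfl, rfl⟩
  set J : Matrix (Fin p) (Fin 2) ℂ :=
    (1 : Matrix (Fin p) (Fin p) ℂ).submatrix id (Fin.castLE hp) with hJ
  have hJJ : Jᴴ * J = 1 := by
    rw [hJ, conjTranspose_submatrix, ← submatrix_mul _ _ _ _ _ Function.bijective_id,
      conjTranspose_one, Matrix.mul_one, submatrix_one _ (Fin.castLE_injective hp)]
  have hsv : ∀ M : Matrix (Fin 2) (Fin 2) ℂ, singularValues (J * M) = singularValues M :=
    fun M => singularValues_congr (by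
      rw [conjTranspose_mul, Matrix.mul_assoc, ← Matrix.mul_assoc Jᴴ, hJJ, Matrix.one_mul])
  exact ⟨J * A, J * B, J * C, by rw [← Matrix.mul_add, ← Matrix.mul_add, h, Matrix.mul_zero],
    hsv A, hsv B, hsv C⟩

/-- For every `p ≥ 2`, `Singular(p,2) = Singular(2,2)`; in particular
`Singular(∞,2) = ⋃_{p ≥ 2} Singular(p,2)` equals `Singular(2,2)`. -/
theorem singular_infty_two :
    (∀ p, 2 ≤ p → SingularCone p 2 = SingularCone 2 2) ∧
      (⋃ p, ⋃ (_ : 2 ≤ p), SingularCone p 2) = SingularCone 2 2 := by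
  have h : ∀ p, 2 ≤ p → SingularCone p 2 = SingularCone 2 2 := fun p hp =>
    (singularCone_subset hp).antisymm (subset_singularCone hp)
  exact ⟨h, (Set.iUnion₂_subset fun p hp => (h p hp).subset).antisymm
    (Set.subset_biUnion_of_mem (u := fun p => SingularCone p 2) (show 2 ≤ 2 from le_rfl))⟩
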